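/- arXiv:1311.1765 — 2 statements merged into one kernel-verified Lean document; each statement's English description precedes it below -/
import Mathlib

section
/- If G=(V,A) and G'=(V,A') are two finite digraphs on the same vertex set that are (≤6)-hypomorphic, then G and G' are isomorphic; equivalently, every finite digraph is (≤6)-reconstructible. -/
universe u v

/-- A digraph: an irreflexive binary relation on a vertex type. -/
structure Dgraph (V : Type u) where
  Arc : V → V → Prop
  irrefl : ∀ x, ¬ Arc x x

namespace Dgraph

variable {V : Type u} {W : Type v}

/-- The dual digraph. -/
def dual (G : Dgraph V) : Dgraph V :=
  ⟨fun x y => G.Arc y x, fun x h => G.irrefl x h⟩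

/-- Subdigraph induced by a set of vertices. -/
def ind (G : Dgraph V) (X : Set V) : Dgraph X :=
  ⟨fun x y => G.Arc x y, fun x h => G.irrefl x h⟩

/-- Isomorphism of digraphs. -/
def Iso (G : Dgraph V) (G' : Dgraph W) : Prop :=
  ∃ e : V ≃ W, ∀ x y, G.Arc x y ↔ G'.Arc (e x) (e y)

/-- `G` and `G'` are hemimorphic: `G'` is isomorphic to `G` or to its dual. -/
def Hemi (G : Dgraph V) (G' : Dgraph W) : Prop :=
  Iso G G' ∨ Iso G.dual G'

/-- Self-dual digraph. -/
def SelfDual (G : Dgraph V) : Prop := Iso G G.dual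

/-- `{x,y}` is a directed pair. -/
def Dir (G : Dgraph V) (x y : V) : Prop :=
  (G.Arc x y ∧ ¬ G.Arc y x) ∨ (G.Arc y x ∧ ¬ G.Arc x y)

/-- `{x,y}` is a neutral pair (full or void). -/
def Neutral (G : Dgraph V) (x y : V) : Prop :=
  x ≠ y ∧ ¬ G.Dir x y

/-- Interval of a digraph. -/
def IsInterval (G : Dgraph V) (I : Set V) : Prop :=
  ∀ x ∉ I,
    (∀ y ∈ I, G.Arc x y ∧ ¬ G.Arc y x) ∨ (∀ y ∈ I, G.Arc y x ∧ ¬ G.Arc x y) ∨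
    (∀ y ∈ I, G.Arc x y ∧ G.Arc y x) ∨ (∀ y ∈ I, ¬ G.Arc x y ∧ ¬ G.Arc y x)

/-- The arc-connectivity equivalence relation. -/
def ACRel (G : Dgraph V) : V → V → Prop := Relation.ReflTransGen G.Dir

/-- Arc-connected components. -/
def IsACComponent (G : Dgraph V) (D : Set V) : Prop :=
  ∃ x, D = {y | G.ACRel x y}

/-- Arc-connected digraph (at most one arc-connected component). -/
def ArcConnected (G : Dgraph V) : Prop := ∀ x y, G.ACRel x y

/-- Tournament. -/
def IsTournament (G : Dgraph V) : Prop := ∀ x y, x ≠ y → G.Dir x y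

/-- Chain (transitive tournament). -/
def IsChainD (G : Dgraph V) : Prop :=
  G.IsTournament ∧ ∀ x y z, G.Arc x y → G.Arc y z → G.Arc x z

/-- Dgraph from a relation, with forced irreflexivity. -/
def ofRel (r : V → V → Prop) : Dgraph V := ⟨fun x y => x ≠ y ∧ r x y, fun x h => h.1 rfl⟩

/-- The model flag. -/
def flagD : Dgraph (Fin 3) :=
  ofRel (fun x y => (x = 0 ∧ y = 1) ∨ (x = 1 ∧ y = 2) ∨ (x = 2 ∧ y = 1))

/-- First model peak. -/
def peakD1 : Dgraph (Fin 3) :=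
  ofRel (fun x y => (x = 0 ∧ y = 1) ∨ (x = 0 ∧ y = 2) ∨ (x = 1 ∧ y = 2) ∨ (x = 2 ∧ y = 1))

/-- Second model peak. -/
def peakD2 : Dgraph (Fin 3) :=
  ofRel (fun x y => (x = 0 ∧ y = 1) ∨ (x = 0 ∧ y = 2))

/-- The model diamond. -/
def diamondD : Dgraph (Fin 4) :=
  ofRel (fun x y => (x = 0 ∧ y = 1) ∨ (x = 0 ∧ y = 2) ∨ (x = 0 ∧ y = 3) ∨
    (x = 1 ∧ y = 2) ∨ (x = 2 ∧ y = 3) ∨ (x = 3 ∧ y = 1))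

/-- A flag is a digraph hemimorphic to the model flag. -/
def IsFlag (G : Dgraph V) : Prop := Hemi G flagD

/-- A peak is a digraph hemimorphic to one of the two model peaks. -/
def IsPeak (G : Dgraph V) : Prop := Hemi G peakD1 ∨ Hemi G peakD2

/-- A diamond is a digraph hemimorphic to the model diamond. -/
def IsDiamond (G : Dgraph V) : Prop := Hemi G diamondD

/-- Prechain: embeds no peak, no diamond, no two adjacent neutral pairs. -/
def IsPrechain (G : Dgraph V) : Prop :=
  (∀ X : Set V, ¬ IsPeak (G.ind X)) ∧ (∀ X : Set V, ¬ IsDiamond (G.ind X)) ∧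
  ¬ ∃ x y z : V, y ≠ z ∧ G.Neutral x y ∧ G.Neutral x z

/-- Proper prechain: a prechain which is not a chain. -/
def ProperPrechain (G : Dgraph V) : Prop := G.IsPrechain ∧ ¬ G.IsChainD

/-- Diamond-free tournament. -/
def DiamondFreeTournament (G : Dgraph V) : Prop :=
  G.IsTournament ∧ ∀ X : Set V, ¬ IsDiamond (G.ind X)

/-- Non-tournament prechain. -/
def NonTournamentPrechain (G : Dgraph V) : Prop := G.IsPrechain ∧ ¬ G.IsTournament

/-- Model finite consecutivity on `n` vertices (`full` decides whether the
non-consecutive pairs are all full or all void). -/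
def consecFin (n : ℕ) (full : Bool) : Dgraph (Fin n) :=
  ofRel (fun i j => i.1 + 1 = j.1 ∨ (full = true ∧ (i.1 + 1 < j.1 ∨ j.1 + 1 < i.1)))

/-- Model consecutivity of type ω. -/
def consecNat (full : Bool) : Dgraph ℕ :=
  ofRel (fun i j => i + 1 = j ∨ (full = true ∧ (i + 1 < j ∨ j + 1 < i)))

/-- Model consecutivity of type ω*+ω. -/
def consecInt (full : Bool) : Dgraph ℤ :=
  ofRel (fun i j => i + 1 = j ∨ (full = true ∧ (i + 1 < j ∨ j + 1 < i)))

/-- One-end infinite consecutivity (obtained from ω or ω*). -/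
def OneEndInfiniteConsecutivity (G : Dgraph V) : Prop :=
  ∃ full, Iso G (consecNat full) ∨ Iso G (consecNat full).dual

/-- Consecutivity. -/
def IsConsecutivity (G : Dgraph V) : Prop :=
  (∃ n, 3 ≤ n ∧ ∃ full, Iso G (consecFin n full)) ∨
  G.OneEndInfiniteConsecutivity ∨ (∃ full, Iso G (consecInt full))

/-- Model cycle on `n ≥ 3` vertices obtained from the finite consecutivity by
replacing the neutral pair `{0, n-1}` by the arc `(n-1, 0)`. -/
def cycleD (n : ℕ) (full : Bool) : Dgraph (Fin n) :=
  ofRel (fun i j => i.1 + 1 = j.1 ∨ (i.1 = n - 1 ∧ j.1 = 0) ∨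
    (full = true ∧ (i.1 + 1 < j.1 ∨ j.1 + 1 < i.1) ∧
      ¬ (i.1 = 0 ∧ j.1 = n - 1) ∧ ¬ (i.1 = n - 1 ∧ j.1 = 0)))

/-- Cycle. -/
def IsCycle (G : Dgraph V) : Prop := ∃ n, 3 ≤ n ∧ ∃ full, Iso G (cycleD n full)

/-- Near-chain: obtained from a chain by exchanging the directed pair formed
by its extremities. -/
def IsNearChain (G : Dgraph V) : Prop :=
  ∃ (H : Dgraph V) (m M : V), H.IsChainD ∧ m ≠ M ∧
    (∀ x, x ≠ m → H.Arc m x) ∧ (∀ x, x ≠ M → H.Arc x M) ∧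
    (∀ x y, G.Arc x y ↔ ((H.Arc x y ∧ ¬ (x = m ∧ y = M)) ∨ (x = M ∧ y = m)))

/-- `{k}`-hypomorphy. -/
def KHypo (k : ℕ) (G G' : Dgraph V) : Prop :=
  ∀ X : Set V, X.Finite → X.ncard = k → Iso (G.ind X) (G'.ind X)

/-- `(≤ k)`-hypomorphy. -/
def LeHypo (k : ℕ) (G G' : Dgraph V) : Prop :=
  ∀ j, 1 ≤ j → j ≤ k → KHypo j G G'

/-- `{k}`-hemimorphy. -/
def KHemi (k : ℕ) (G G' : Dgraph V) : Prop :=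
  ∀ X : Set V, X.Finite → X.ncard = k → Hemi (G.ind X) (G'.ind X)

/-- `(≤ k)`-hemimorphy. -/
def LeHemi (k : ℕ) (G G' : Dgraph V) : Prop :=
  ∀ j, 1 ≤ j → j ≤ k → KHemi j G G'

/-- `(≤ k)`-half-reconstructibility. -/
def HalfRecon (k : ℕ) (G : Dgraph V) : Prop :=
  ∀ G' : Dgraph V, LeHemi k G G' → Hemi G G'

/-- One step of the difference relation. -/
def DiffStep (G G' : Dgraph V) (x y : V) : Prop := G.Arc x y ↔ ¬ G'.Arc x y

/-- The difference relation `𝔇_{G,G'}`. -/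
def DiffRel (G G' : Dgraph V) (x y : V) : Prop :=
  x = y ∨ Relation.TransGen (DiffStep G G') x y

/-- Difference classes: `C ∈ D_{G,G'}`. -/
def DiffClass (G G' : Dgraph V) (C : Set V) : Prop :=
  ∃ x, C = {y | DiffRel G G' x y}

/-- The difference relation has at least two equivalence classes. -/
def AtLeastTwoDiffClasses (G G' : Dgraph V) : Prop :=
  ∃ C₁ C₂ : Set V, DiffClass G G' C₁ ∧ DiffClass G G' C₂ ∧ C₁ ≠ C₂

/-- `C_dual(G)`: the smallest cardinality of a finite set of vertices inducing a
non-self-dual subdigraph (`⊤` if there is none). -/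
noncomputable def Cdual (G : Dgraph V) : ℕ∞ :=
  sInf {n : ℕ∞ | ∃ X : Set V, X.Finite ∧ ¬ SelfDual (G.ind X) ∧ n = (X.ncard : ℕ∞)}

/-- The contracted digraph `G_I` (the vertex `none` plays the role of `I`). -/
def contract (G : Dgraph V) (I : Set V) : Dgraph (Option {x : V // x ∉ I}) where
  Arc := fun a b =>
    match a, b with
    | some x, some y => G.Arc x.1 y.1
    | some x, none => ∃ z ∈ I, G.Arc x.1 z
    | none, some y => ∃ z ∈ I, G.Arc z y.1
    | none, none => False
  irrefl := by
    rintro (_ | ⟨x, hx⟩)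
    · simp
    · exact G.irrefl x

/-- There is an isomorphism `f` from `G_I` onto `G'_I` with `f(I) = I`. -/
def ContractIsoFix (G G' : Dgraph V) (I : Set V) : Prop :=
  ∃ e : Option {x : V // x ∉ I} ≃ Option {x : V // x ∉ I},
    e none = none ∧ ∀ a b, (G.contract I).Arc a b ↔ (G'.contract I).Arc (e a) (e b)

/-- `D` is disjoint from every flag of `G`. -/
def FlagDisjoint (G : Dgraph V) (D : Set V) : Prop :=
  ∀ F : Set V, IsFlag (G.ind F) → D ∩ F = ∅

/-- `D` contains a vertex `a` of a flag `{a,b,c}` of `G` with `b, c ∉ D` and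
`{b,c}` the directed pair of the flag. -/
def FlagVertexCond (G : Dgraph V) (D : Set V) : Prop :=
  ∃ a ∈ D, ∃ b c : V, b ∉ D ∧ c ∉ D ∧ IsFlag (G.ind {a, b, c}) ∧ G.Dir b c

/-- Condition `C_∞`. -/
def CondCinf (G : Dgraph V) : Prop :=
  (∃ I : Set V, I.Infinite ∧ G.IsInterval I ∧ (G.ind I).IsChainD) ∨
  (∃ I J : Set V, I ≠ J ∧ G.IsInterval I ∧ G.IsInterval J ∧
     (G.ind I).OneEndInfiniteConsecutivity ∧ (G.ind J).OneEndInfiniteConsecutivity) ∨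
  (∃ I : Set V, G.IsInterval I ∧ (G.ind I).OneEndInfiniteConsecutivity ∧
     (∀ J : Set V, G.IsInterval J → (G.ind J).OneEndInfiniteConsecutivity → J = I) ∧
     ¬ ContractIsoFix G G.dual I)

/-- The kind of component occurring in conditions `K1` and `K2`. -/
def K12Kind (G : Dgraph V) (D : Set V) : Prop :=
  DiamondFreeTournament (G.ind D) ∨ (NonTournamentPrechain (G.ind D) ∧ G.FlagDisjoint D)

/-- Condition `K1`. -/
def CondK1 (G : Dgraph V) : Prop :=
  G.Cdual = 3 ∧ ∃ D₁ D₂ : Set V, D₁ ≠ D₂ ∧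
    (G.IsACComponent D₁ ∧ ¬ SelfDual (G.ind D₁) ∧ G.IsInterval D₁ ∧ G.K12Kind D₁) ∧
    (G.IsACComponent D₂ ∧ ¬ SelfDual (G.ind D₂) ∧ G.IsInterval D₂ ∧ G.K12Kind D₂)

/-- Condition `K2`. -/
def CondK2 (G : Dgraph V) : Prop :=
  G.Cdual = 3 ∧ ∃ D₀ : Set V, G.IsACComponent D₀ ∧ ¬ SelfDual (G.ind D₀) ∧
    (∀ D, G.IsACComponent D → ¬ SelfDual (G.ind D) → D = D₀) ∧
    G.K12Kind D₀ ∧ ¬ ContractIsoFix G G.dual D₀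

/-- Condition `K3`. -/
def CondK3 (G : Dgraph V) : Prop :=
  G.Cdual = 4 ∧ ∃ D₁ D₂ : Set V, D₁ ≠ D₂ ∧
    (G.IsACComponent D₁ ∧ ¬ SelfDual (G.ind D₁) ∧ G.IsInterval D₁) ∧
    (G.IsACComponent D₂ ∧ ¬ SelfDual (G.ind D₂) ∧ G.IsInterval D₂)

/-- Condition `K4`. -/
def CondK4 (G : Dgraph V) : Prop :=
  G.Cdual = 5 ∧ ∃ D₁ D₂ : Set V, D₁ ≠ D₂ ∧
    (G.IsACComponent D₁ ∧ ¬ SelfDual (G.ind D₁) ∧ G.IsInterval D₁ ∧ IsPrechain (G.ind D₁)) ∧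
    (G.IsACComponent D₂ ∧ ¬ SelfDual (G.ind D₂) ∧ G.IsInterval D₂ ∧ IsPrechain (G.ind D₂))

/-- Condition `K5`. -/
def CondK5 (G : Dgraph V) : Prop :=
  G.Cdual = 6 ∧ ∃ D₁ D₂ : Set V, D₁ ≠ D₂ ∧
    (G.IsACComponent D₁ ∧ ¬ SelfDual (G.ind D₁) ∧ G.IsInterval D₁ ∧
      DiamondFreeTournament (G.ind D₁)) ∧
    (G.IsACComponent D₂ ∧ ¬ SelfDual (G.ind D₂) ∧ G.IsInterval D₂ ∧
      DiamondFreeTournament (G.ind D₂))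

/-- The kind of interval occurring in conditions `L1` and `L2`. -/
def L12Int (G : Dgraph V) (I : Set V) : Prop :=
  G.IsInterval I ∧ DiamondFreeTournament (G.ind I) ∧ ¬ SelfDual (G.ind I) ∧
    ¬ G.IsACComponent I

/-- Condition `L1`. -/
def CondL1 (G : Dgraph V) : Prop :=
  ∃ I₁ I₂ : Set V, I₁ ≠ I₂ ∧ G.L12Int I₁ ∧ G.L12Int I₂

/-- Condition `L2`. -/
def CondL2 (G : Dgraph V) : Prop :=
  ∃ I₀ : Set V, G.L12Int I₀ ∧ (∀ I, G.L12Int I → I = I₀) ∧ ¬ ContractIsoFix G G.dual I₀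

/-- Condition `L3`. -/
def CondL3 (G : Dgraph V) : Prop :=
  G.Cdual = 3 ∧ ∃ D₁ D₂ : Set V, D₁ ≠ D₂ ∧
    (G.IsACComponent D₁ ∧ ¬ SelfDual (G.ind D₁) ∧ G.IsInterval D₁) ∧
    (G.IsACComponent D₂ ∧ ¬ SelfDual (G.ind D₂) ∧ G.IsInterval D₂) ∧
    ((G.FlagDisjoint D₁ ∧ Cdual (G.ind D₁) = 4 ∧ G.FlagDisjoint D₂ ∧ Cdual (G.ind D₂) = 4) ∨
     (NonTournamentPrechain (G.ind D₁) ∧ G.FlagVertexCond D₁ ∧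
      NonTournamentPrechain (G.ind D₂) ∧ G.FlagVertexCond D₂))

/-- Condition `L4`. -/
def CondL4 (G : Dgraph V) : Prop :=
  G.Cdual = 3 ∧ ∃ D₀ : Set V, G.IsACComponent D₀ ∧ ¬ SelfDual (G.ind D₀) ∧
    (∀ D, G.IsACComponent D → ¬ SelfDual (G.ind D) → D = D₀) ∧
    G.IsInterval D₀ ∧
    ((G.FlagDisjoint D₀ ∧ Cdual (G.ind D₀) = 4) ∨
     (NonTournamentPrechain (G.ind D₀) ∧ G.FlagVertexCond D₀)) ∧
    ¬ ContractIsoFix G G.dual D₀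

end Dgraph

namespace Dgraph
namespace Lopez

/-- The type of an ordered pair of vertices of a digraph. -/
inductive Col
  | full | void | fwd | bwd
  deriving DecidableEq

/-- The joint type of an ordered pair in two `2`-hypomorphic digraphs: a directed pair is either
kept (`kfwd`, `kbwd`) or reversed (`hfwd`, `hbwd`). -/
inductive Edge
  | full | void | kfwd | kbwd | hfwd | hbwd
  deriving DecidableEq

instance Col.decidableForall (P : Col → Prop) [DecidablePred P] : Decidable (∀ p, P p) :=
  decidable_of_iff (P .full ∧ P .void ∧ P .fwd ∧ P .bwd)
    ⟨fun h p => by cases p <;> simp [h], fun h => ⟨h _, h _, h _, h _⟩⟩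

instance Edge.decidableForall (P : Edge → Prop) [DecidablePred P] : Decidable (∀ p, P p) :=
  decidable_of_iff (P .full ∧ P .void ∧ P .kfwd ∧ P .kbwd ∧ P .hfwd ∧ P .hbwd)
    ⟨fun h p => by cases p <;> simp [h], fun h => ⟨h _, h _, h _, h _, h _, h _⟩⟩

namespace Col

/-- The type of the reversed pair. -/
def op : Col → Col
  | full => full | void => void | fwd => bwd | bwd => fwd

/-- Being directed. -/
def dir : Col → Bool
  | full => false | void => false | fwd => true | bwd => true

@[simp] theorem op_op (p : Col) : p.op.op = p := by cases p <;> rfl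

@[simp] theorem op_void : Col.op .void = .void := rfl

@[simp] theorem dir_op (p : Col) : p.op.dir = p.dir := by cases p <;> rfl

/-- A weight separating the types of pairs. -/
def wt : Col → ℕ
  | full => 64 | void => 0 | fwd => 1 | bwd => 8

/-- A weight depending on the type of a pair and on the weight of its second vertex. -/
def wt₂ : Col → ℕ → ℕ
  | full, _ => 0 | void, _ => 0 | fwd, r => r * r | bwd, r => 65536 * (r * r)

end Col

namespace Edge

/-- The joint type of the reversed pair. -/
def op : Edge → Edge
  | full => full | void => void | kfwd => kbwd | kbwd => kfwd | hfwd => hbwd | hbwd => hfwd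

/-- The type in the first digraph. -/
def lo : Edge → Col
  | full => .full | void => .void | kfwd => .fwd | kbwd => .bwd | hfwd => .fwd | hbwd => .bwd

/-- The type in the second digraph. -/
def up : Edge → Col
  | full => .full | void => .void | kfwd => .fwd | kbwd => .bwd | hfwd => .bwd | hbwd => .fwd

/-- Being directed and reversed. -/
def isH : Edge → Bool
  | hfwd => true | hbwd => true | _ => false

/-- Being directed and kept. -/
def isK : Edge → Bool
  | kfwd => true | kbwd => true | _ => false

/-- The joint type determined by the two types. -/
def enc : Col → Col → Edge
  | .full, _ => full | .void, _ => void
  | .fwd, .bwd => hfwd | .fwd, _ => kfwd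
  | .bwd, .fwd => hbwd | .bwd, _ => kbwd

@[simp] theorem lo_op (p : Edge) : p.op.lo = p.lo.op := by cases p <;> rfl

@[simp] theorem up_op (p : Edge) : p.op.up = p.up.op := by cases p <;> rfl

@[simp] theorem isH_op (p : Edge) : p.op.isH = p.isH := by cases p <;> rfl

@[simp] theorem isK_op (p : Edge) : p.op.isK = p.isK := by cases p <;> rfl

@[simp] theorem lo_enc (p q : Col) : (enc p q).lo = p := by cases p <;> cases q <;> rfl

theorem up_enc {p q : Col} (h : p = q ∨ p = q.op) : (enc p q).up = q := by
  rcases h with rfl | rfl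
  · cases p <;> rfl
  · cases q <;> rfl

theorem enc_op (p q : Col) : enc p.op q.op = (enc p q).op := by cases p <;> cases q <;> rfl

theorem up_eq_op_lo {p : Edge} (h : p.isK = false) : p.up = p.lo.op := by
  cases p <;> simp_all [isK, up, lo, Col.op]

theorem up_eq_lo {p : Edge} (h : p.isH = false) : p.up = p.lo := by
  cases p <;> simp_all [isH, up, lo]

end Edge

/-- The weights of the vertices of a digraph on `3` vertices. -/
def prof3 (p q r : Col) : List ℕ :=
  [p.wt + q.wt, p.op.wt + r.wt, q.op.wt + r.op.wt]

/-- The weights of the vertices of a digraph on `4` vertices. -/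
def prof4 (p q r s t u : Col) : List ℕ :=
  [p.wt + q.wt + r.wt, p.op.wt + s.wt + t.wt, q.op.wt + s.op.wt + u.wt,
    r.op.wt + t.op.wt + u.op.wt]

/-- Equality of the sets of members of two lists, as a fast boolean test. -/
def sub (l l' : List ℕ) : Bool :=
  (l.all fun a => l'.any fun b => Nat.beq a b) && l'.all fun a => l.any fun b => Nat.beq a b

/-- A consequence of hypomorphy on `3` vertices. -/
def ok3 (p q r : Edge) : Bool := sub (prof3 p.lo q.lo r.lo) (prof3 p.up q.up r.up)

/-- A consequence of hypomorphy on `4` vertices. -/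
def ok4 (p q r s t u : Edge) : Bool :=
  sub (prof4 p.lo q.lo r.lo s.lo t.lo u.lo) (prof4 p.up q.up r.up s.up t.up u.up)

/-- A consequence of self-duality on `3` vertices. -/
def sd3 (p q r : Col) : Bool := sub (prof3 p q r) (prof3 p.op q.op r.op)

/-- A consequence of self-duality on `4` vertices. -/
def sd4 (p q r s t u : Col) : Bool :=
  sub (prof4 p q r s t u) (prof4 p.op q.op r.op s.op t.op u.op)

/-- The vertex `x` sees `y`, `z` in the same way, and `y`, `z` is a neutral pair, or it sees them
through neutral pairs of different types, and `y`, `z` is a kept directed pair. -/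
def apex (p q r : Edge) : Bool :=
  (p.isK && p == q && !r.lo.dir) || (!p.lo.dir && !q.lo.dir && p != q && r.isK)

section

set_option maxRecDepth 100000

theorem ok3_interval : ∀ p q r : Edge, r.isH = true → p.isH = false → q.isH = false →
    ok3 p q r = true → p = q := by decide

theorem apex_closed : ∀ p q r : Edge, apex p q r = true → ∀ s : Edge, s.isH = true → ∀ t : Edge,
    ok3 s t p = true → ∀ u : Edge, ok3 s u q = true → ok3 t u r = true →
    ok4 s t u p q r = true → t = p ∧ u = q := by decide

theorem apex_of_not_sd3 : ∀ p q r : Edge, ok3 p q r = true → sd3 p.lo q.lo r.lo = false →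
    apex p q r = true ∨ apex p.op r q = true ∨ apex q.op r.op p = true := by decide

theorem sd3_interval : ∀ p q r : Edge, r.isK = true → p.isK = false → q.isK = false →
    sd3 p.lo q.lo r.lo = true → ok3 p q r = true → p = q := by decide

/-- A directed `3`-cycle seen in the same directed way by a fourth vertex. -/
def diam (p q r s t u : Col) : Bool :=
  p.dir && p == q && q == r && s == .fwd && t == .bwd && u == .fwd

theorem diam_isK : ∀ p s t u : Edge, diam p.lo p.lo p.lo s.lo t.lo u.lo = true →
    ∀ q : Edge, q.lo = p.lo → ok3 p q s = true → ∀ r : Edge, r.lo = p.lo → ok3 p r t = true →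
    ok3 q r u = true → ok3 s t u = true → ok4 p q r s t u = true →
    p.isK = true ∧ q = p ∧ r = p := by decide

theorem diam_closed : ∀ p a b e : Edge, p.isK = true →
    diam p.lo p.lo p.lo a.lo b.lo e.lo = true → ok3 a b e = true →
    ∀ s : Edge, s.isH = true → ∀ t : Edge, ok3 s t p = true →
    ∀ u : Edge, ok3 s u p = true → ok3 t u a = true → ∀ v : Edge, ok3 s v p = true →
    ok3 t v b = true → ok3 u v e = true → ok4 t u v a b e = true →
    t = p ∧ u = p ∧ v = p := by decide

theorem cycle_same : ∀ p q r : Edge, p.lo = .fwd → q.lo = .bwd → r.lo = .fwd → ok3 p q r = true →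
    (p.isH = true ∧ q.isH = true ∧ r.isH = true) ∨
      (p.isK = true ∧ q.isK = true ∧ r.isK = true) := by decide

theorem cycle_closed : ∀ p q r : Edge, p.lo = .fwd → q.lo = .bwd → r.lo = .fwd →
    ok3 p q r = true → ∀ s : Edge,
    (p.isH = true ∧ s.isK = true) ∨ (p.isK = true ∧ s.isH = true) →
    ∀ t : Edge, ok3 s t p = true → sd3 s.lo t.lo p.lo = true →
    ∀ u : Edge, ok3 s u q = true → sd3 s.lo u.lo q.lo = true →
    ok3 t u r = true → sd3 t.lo u.lo r.lo = true →
    diam s.lo t.lo u.lo p.lo q.lo r.lo = false → t = p ∧ u = q := by decide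

theorem mid_same : ∀ p q r : Edge, p.lo.dir = true → q.lo.dir = true → r.lo.dir = false →
    ok3 p q r = true →
    (p.isH = true ∧ q.isH = true) ∨ (p.isK = true ∧ q.isK = true) := by decide

theorem mid_closed : ∀ p q r : Edge, p.lo.dir = true → q.lo.dir = true → r.lo.dir = false →
    ok3 p q r = true → sd3 p.lo q.lo r.lo = true → ∀ s : Edge,
    (p.isH = true ∧ s.isK = true) ∨ (p.isK = true ∧ s.isH = true) →
    ∀ t : Edge, ok3 s t p = true → sd3 s.lo t.lo p.lo = true →
    ∀ u : Edge, ok3 s u q = true → sd3 s.lo u.lo q.lo = true →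
    ok3 t u r = true → sd3 t.lo u.lo r.lo = true → t = p ∧ u = q := by decide

theorem up_cycle : ∀ p q r : Edge, p.up = .fwd → q.up = .bwd → r.up = .fwd → ok3 p q r = true →
    (p.lo = .fwd ∧ q.lo = .bwd ∧ r.lo = .fwd) ∨
      (p.lo = .bwd ∧ q.lo = .fwd ∧ r.lo = .bwd) := by decide

theorem peak_not_sd3 : ∀ p q : Col, p.dir = true → sd3 p p q = true → q.dir = true := by decide

end

/-- A pair-colouring of the vertices, compatible with the reversal of pairs. -/
def Skew {U : Type*} (d : U → U → Col) : Prop :=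
  (∀ x, d x x = .void) ∧ ∀ x y, d y x = (d x y).op

/-- Isomorphism of pair-colourings. -/
def Eqv {U U' : Type*} (d : U → U → Col) (d' : U' → U' → Col) : Prop :=
  ∃ e : U ≃ U', ∀ x y, d x y = d' (e x) (e y)

/-- Hypomorphy up to `6` for pair-colourings. -/
def Hyp {U : Type*} (d d' : U → U → Col) : Prop :=
  ∀ k ≤ 6, ∀ f : Fin k → U, Function.Injective f →
    Eqv (fun i j => d (f i) (f j)) (fun i j => d' (f i) (f j))

/-- The reversed pair-colouring. -/
def rev {U : Type*} (d : U → U → Col) : U → U → Col := fun x y => (d x y).op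

theorem Skew.comp {U U' : Type*} {d : U → U → Col} (h : Skew d) (f : U' → U) :
    Skew fun x y => d (f x) (f y) :=
  ⟨fun _ => h.1 _, fun _ _ => h.2 _ _⟩

theorem Skew.rev {U : Type*} {d : U → U → Col} (h : Skew d) : Skew (rev d) :=
  ⟨fun x => by simp [Lopez.rev, h.1 x], fun x y => by simp [Lopez.rev, h.2 x y]⟩

theorem Hyp.comp {U U' : Type*} {d d' : U → U → Col} (h : Hyp d d') {f : U' → U}
    (hf : Function.Injective f) : Hyp (fun x y => d (f x) (f y)) (fun x y => d' (f x) (f y)) :=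
  fun k hk g hg => h k hk (f ∘ g) (hf.comp hg)

theorem Eqv.trans {U U' U'' : Type*} {d : U → U → Col} {d' : U' → U' → Col} {d'' : U'' → U'' → Col}
    (h : Eqv d d') (h' : Eqv d' d'') : Eqv d d'' := by
  obtain ⟨e, he⟩ := h
  obtain ⟨e', he'⟩ := h'
  exact ⟨e.trans e', fun x y => by simp [he, he']⟩

theorem Eqv.symm {U U' : Type*} {d : U → U → Col} {d' : U' → U' → Col}
    (h : Eqv d d') : Eqv d' d := by
  obtain ⟨e, he⟩ := h
  exact ⟨e.symm, fun x y => by simp [he]⟩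

theorem sub_ofFn {n : ℕ} {P P' : Fin n → ℕ} (e : Fin n ≃ Fin n) (h : ∀ i, P i = P' (e i)) :
    sub (List.ofFn P) (List.ofFn P') = true := by
  simp only [sub, Bool.and_eq_true, List.all_eq_true, List.any_eq_true, List.mem_ofFn,
    Nat.beq_eq]
  constructor
  · rintro _ ⟨i, rfl⟩
    exact ⟨_, ⟨e i, rfl⟩, h i⟩
  · rintro _ ⟨i, rfl⟩
    exact ⟨_, ⟨e.symm i, rfl⟩, by simp [h]⟩

/-- The weight of a vertex. -/
def wsum {n : ℕ} (d : Fin n → Fin n → Col) (i : Fin n) : ℕ := ∑ j, (d i j).wt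

theorem wsum_eq {n : ℕ} {d d' : Fin n → Fin n → Col} {e : Fin n ≃ Fin n}
    (he : ∀ x y, d x y = d' (e x) (e y)) (i : Fin n) :
    wsum d i = wsum d' (e i) := by
  simp only [wsum, he, Equiv.sum_comp e fun k => (d' (e i) k).wt]

/-- The second-level weight of a vertex. -/
def wsum₂ {n : ℕ} (d : Fin n → Fin n → Col) (i : Fin n) : ℕ :=
  ∑ j, (d i j).wt₂ (wsum d j)

theorem wsum₂_eq {n : ℕ} {d d' : Fin n → Fin n → Col} {e : Fin n ≃ Fin n}
    (he : ∀ x y, d x y = d' (e x) (e y)) (i : Fin n) : wsum₂ d i = wsum₂ d' (e i) := by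
  simp only [wsum₂, wsum_eq he, he, Equiv.sum_comp e fun k => (d' (e i) k).wt₂ (wsum d' k)]

theorem sub_prof3 {d d' : Fin 3 → Fin 3 → Col} (hd : Skew d) (hd' : Skew d') (h : Eqv d d') :
    sub (prof3 (d 0 1) (d 0 2) (d 1 2)) (prof3 (d' 0 1) (d' 0 2) (d' 1 2)) = true := by
  obtain ⟨e, he⟩ := h
  convert sub_ofFn e (wsum_eq he) using 1
  simp [prof3, wsum, Fin.sum_univ_three, hd.1, hd'.1, hd.2 0 1, hd.2 0 2, hd.2 1 2, hd'.2 0 1,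
    hd'.2 0 2, hd'.2 1 2, Col.wt]

theorem sub_prof4 {d d' : Fin 4 → Fin 4 → Col} (hd : Skew d) (hd' : Skew d') (h : Eqv d d') :
    sub (prof4 (d 0 1) (d 0 2) (d 0 3) (d 1 2) (d 1 3) (d 2 3))
      (prof4 (d' 0 1) (d' 0 2) (d' 0 3) (d' 1 2) (d' 1 3) (d' 2 3)) = true := by
  obtain ⟨e, he⟩ := h
  convert sub_ofFn e (wsum_eq he) using 1
  simp [prof4, wsum, Fin.sum_univ_four, hd.1, hd'.1, hd.2 0 1, hd.2 0 2, hd.2 1 2, hd.2 0 3, hd.2 1 3,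
    hd.2 2 3, hd'.2 0 1, hd'.2 0 2, hd'.2 1 2, hd'.2 0 3, hd'.2 1 3, hd'.2 2 3, Col.wt]

/-- The second-level weights of the vertices of a digraph on `6` vertices, given by its pairs in
lexicographic order. -/
def prof6 (p₁ p₂ p₃ p₄ p₅ q₂ q₃ q₄ q₅ r₃ r₄ r₅ s₄ s₅ t₅ : Col) : List ℕ :=
  let w₀ := p₁.wt + p₂.wt + p₃.wt + p₄.wt + p₅.wt
  let w₁ := p₁.op.wt + q₂.wt + q₃.wt + q₄.wt + q₅.wt
  let w₂ := p₂.op.wt + q₂.op.wt + r₃.wt + r₄.wt + r₅.wt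
  let w₃ := p₃.op.wt + q₃.op.wt + r₃.op.wt + s₄.wt + s₅.wt
  let w₄ := p₄.op.wt + q₄.op.wt + r₄.op.wt + s₄.op.wt + t₅.wt
  let w₅ := p₅.op.wt + q₅.op.wt + r₅.op.wt + s₅.op.wt + t₅.op.wt
  [p₁.wt₂ w₁ + p₂.wt₂ w₂ + p₃.wt₂ w₃ + p₄.wt₂ w₄ + p₅.wt₂ w₅,
    p₁.op.wt₂ w₀ + q₂.wt₂ w₂ + q₃.wt₂ w₃ + q₄.wt₂ w₄ + q₅.wt₂ w₅,
    p₂.op.wt₂ w₀ + q₂.op.wt₂ w₁ + r₃.wt₂ w₃ + r₄.wt₂ w₄ + r₅.wt₂ w₅,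
    p₃.op.wt₂ w₀ + q₃.op.wt₂ w₁ + r₃.op.wt₂ w₂ + s₄.wt₂ w₄ + s₅.wt₂ w₅,
    p₄.op.wt₂ w₀ + q₄.op.wt₂ w₁ + r₄.op.wt₂ w₂ + s₄.op.wt₂ w₃ + t₅.wt₂ w₅,
    p₅.op.wt₂ w₀ + q₅.op.wt₂ w₁ + r₅.op.wt₂ w₂ + s₅.op.wt₂ w₃ + t₅.op.wt₂ w₄]

/-- A consequence of self-duality on `6` vertices. -/
def sd6 (p₁ p₂ p₃ p₄ p₅ q₂ q₃ q₄ q₅ r₃ r₄ r₅ s₄ s₅ t₅ : Col) : Bool :=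
  sub (prof6 p₁ p₂ p₃ p₄ p₅ q₂ q₃ q₄ q₅ r₃ r₄ r₅ s₄ s₅ t₅)
    (prof6 p₁.op p₂.op p₃.op p₄.op p₅.op q₂.op q₃.op q₄.op q₅.op r₃.op r₄.op r₅.op s₄.op s₅.op
      t₅.op)

theorem ofFn_wsum₂ {d : Fin 6 → Fin 6 → Col} (hd : Skew d) :
    List.ofFn (wsum₂ d) = prof6 (d 0 1) (d 0 2) (d 0 3) (d 0 4) (d 0 5) (d 1 2) (d 1 3) (d 1 4)
      (d 1 5) (d 2 3) (d 2 4) (d 2 5) (d 3 4) (d 3 5) (d 4 5) := by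
  simp [prof6, wsum, wsum₂, List.ofFn_succ, Fin.sum_univ_six, hd.1, hd.2 0 1, hd.2 0 2, hd.2 0 3,
    hd.2 0 4, hd.2 0 5, hd.2 1 2, hd.2 1 3, hd.2 1 4, hd.2 1 5, hd.2 2 3, hd.2 2 4, hd.2 2 5,
    hd.2 3 4, hd.2 3 5, hd.2 4 5, Col.wt, Col.wt₂]

section Profiles

variable {U : Type*} {d d' : U → U → Col} {x y z w : U}

theorem Hyp.prof3 (h : Hyp d d') (hd : Skew d) (hd' : Skew d') (hxy : x ≠ y) (hxz : x ≠ z)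
    (hyz : y ≠ z) : sub (prof3 (d x y) (d x z) (d y z)) (prof3 (d' x y) (d' x z) (d' y z)) := by
  have hf : Function.Injective ![x, y, z] := by
    intro i j
    fin_cases i <;> fin_cases j <;> simp [hxy, hxz, hyz, hxy.symm, hxz.symm, hyz.symm]
  exact sub_prof3 (hd.comp _) (hd'.comp _) (h 3 (by norm_num) _ hf)

theorem Hyp.prof4 (h : Hyp d d') (hd : Skew d) (hd' : Skew d') (hxy : x ≠ y) (hxz : x ≠ z)
    (hxw : x ≠ w) (hyz : y ≠ z) (hyw : y ≠ w) (hzw : z ≠ w) :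
    sub (prof4 (d x y) (d x z) (d x w) (d y z) (d y w) (d z w))
      (prof4 (d' x y) (d' x z) (d' x w) (d' y z) (d' y w) (d' z w)) := by
  have hf : Function.Injective ![x, y, z, w] := by
    intro i j
    fin_cases i <;> fin_cases j <;> simp [hxy, hxz, hyz, hxy.symm, hxz.symm, hyz.symm, hxw, hyw,
      hzw, hxw.symm, hyw.symm, hzw.symm]
  exact sub_prof4 (hd.comp _) (hd'.comp _) (h 4 (by norm_num) _ hf)

theorem Hyp.sd6 (h : Hyp d (rev d)) (hd : Skew d) {f : Fin 6 → U} (hf : Function.Injective f) :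
    sd6 (d (f 0) (f 1)) (d (f 0) (f 2)) (d (f 0) (f 3)) (d (f 0) (f 4)) (d (f 0) (f 5))
      (d (f 1) (f 2)) (d (f 1) (f 3)) (d (f 1) (f 4)) (d (f 1) (f 5)) (d (f 2) (f 3))
      (d (f 2) (f 4)) (d (f 2) (f 5)) (d (f 3) (f 4)) (d (f 3) (f 5)) (d (f 4) (f 5)) = true := by
  obtain ⟨e, he⟩ := h 6 le_rfl f hf
  have := sub_ofFn e (wsum₂_eq (d := fun i j => d (f i) (f j))
    (d' := fun i j => rev d (f i) (f j)) he)
  rwa [ofFn_wsum₂ (hd.comp f), ofFn_wsum₂ (hd.rev.comp f)] at this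

theorem Hyp.eq_or_eq_op (h : Hyp d d') (hd : Skew d) (hd' : Skew d') (x y : U) :
    d x y = d' x y ∨ d x y = (d' x y).op := by
  rcases eq_or_ne x y with rfl | hxy
  · simp [hd.1, hd'.1]
  · have hf : Function.Injective ![x, y] := by
      intro i j
      fin_cases i <;> fin_cases j <;> simp [hxy, hxy.symm]
    obtain ⟨e, he⟩ := h 2 (by norm_num) _ hf
    have h01 : d x y = d' (![x, y] (e 0)) (![x, y] (e 1)) := he 0 1
    have hne : e 0 ≠ e 1 := e.injective.ne (by simp)
    rw [h01]
    generalize e 0 = i at hne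
    generalize e 1 = j at hne
    fin_cases i <;> fin_cases j
    · exact absurd rfl hne
    · exact Or.inl rfl
    · exact Or.inr (hd'.2 x y)
    · exact absurd rfl hne

end Profiles

theorem eqv_of_fibres {U Q : Type*} {d d' : U → U → Col} (f : U → Q)
    (h : ∀ x y x' y', f x' = f x → f y' = f y → f x ≠ f y → d x y = d' x' y')
    (hf : ∀ q, Eqv (fun x y : {x // f x = q} => d x y) (fun x y : {x // f x = q} => d' x y)) :
    Eqv d d' := by
  choose e he using hf
  have key : ∀ x, f (e (f x) ⟨x, rfl⟩) = f x := fun x => (e (f x) ⟨x, rfl⟩).2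
  have hE : ∀ x, ((Equiv.sigmaFiberEquiv f).symm.trans ((Equiv.sigmaCongrRight e).trans
      (Equiv.sigmaFiberEquiv f))) x = e (f x) ⟨x, rfl⟩ := fun x => rfl
  refine ⟨(Equiv.sigmaFiberEquiv f).symm.trans ((Equiv.sigmaCongrRight e).trans
    (Equiv.sigmaFiberEquiv f)), fun x y => ?_⟩
  rw [hE, hE]
  by_cases hxy : f x = f y
  · have hy : ∀ q (hy : f y = q), (e q ⟨y, hy⟩ : U) = e (f y) ⟨y, rfl⟩ := by
      rintro _ rfl
      rfl
    rw [← hy _ hxy.symm]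
    exact he (f x) ⟨x, rfl⟩ ⟨y, hxy.symm⟩
  · exact h x y _ _ (key x) (key y) hxy

/-- A pair-colouring representing a transitive tournament. -/
def Chain {U : Type*} (d : U → U → Col) : Prop :=
  (∀ x y, x ≠ y → (d x y).dir = true) ∧ ∀ x y z, d x y = .fwd → d y z = .fwd → d x z = .fwd

theorem Col.dir_iff {p : Col} : p.dir = true ↔ p = .fwd ∨ p = .bwd := by
  cases p <;> simp [Col.dir]

theorem chain_of_no_cycle {U : Type*} {d : U → U → Col} (hd : Skew d)
    (h : ∀ x y, x ≠ y → (d x y).dir = true)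
    (hc : ∀ x y z, d x y = .fwd → d y z = .fwd → d x z = .bwd → False) : Chain d := by
  refine ⟨h, fun x y z hxy hyz => ?_⟩
  have hxz : x ≠ z := by
    rintro rfl
    rw [hd.2 x y, hxy] at hyz
    cases hyz
  exact (Col.dir_iff.1 (h x z hxz)).resolve_right fun h' => hc x y z hxy hyz h'

theorem Chain.enum {U : Type*} [Finite U] {d : U → U → Col} (hd : Skew d) (h : Chain d) {n : ℕ}
    (hn : Nat.card U = n) : ∃ e : Fin n ≃ U, ∀ i j, i < j → d (e i) (e j) = .fwd := by
  classical
  have := Fintype.ofFinite U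
  have : IsStrictTotalOrder U (fun x y => d x y = .fwd) :=
    { trichotomous := fun x y hxy hyx => by
        by_contra hne
        rcases Col.dir_iff.1 (h.1 x y hne) with h' | h'
        · exact hxy h'
        · exact hyx (by rw [hd.2, h']; rfl)
      irrefl := fun x hx => by rw [hd.1] at hx; cases hx
      trans := h.2 }
  let _ := linearOrderOfSTO (fun x y => d x y = .fwd)
  let e := Fintype.orderIsoFinOfCardEq U (by rw [← Nat.card_eq_fintype_card, hn])
  exact ⟨e.toEquiv, fun i j hij => e.strictMono hij⟩

theorem eqv_of_enum {U : Type*} {d d' : U → U → Col} (hd : Skew d) (hd' : Skew d') {n : ℕ}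
    (e e' : Fin n ≃ U) (h : ∀ i j, i < j → d (e i) (e j) = d' (e' i) (e' j)) : Eqv d d' := by
  refine ⟨e.symm.trans e', fun x y => ?_⟩
  obtain ⟨i, rfl⟩ := e.surjective x
  obtain ⟨j, rfl⟩ := e.surjective y
  simp only [Equiv.trans_apply, Equiv.symm_apply_apply]
  rcases lt_trichotomy i j with hij | rfl | hij
  · exact h i j hij
  · rw [hd.1, hd'.1]
  · rw [hd.2 (e j), hd'.2 (e' j), h j i hij]

theorem Chain.eqv {U : Type*} [Finite U] {d d' : U → U → Col} (hd : Skew d) (hd' : Skew d')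
    (h : Chain d) (h' : Chain d') : Eqv d d' := by
  obtain ⟨e, he⟩ := h.enum hd rfl
  obtain ⟨e', he'⟩ := h'.enum hd' rfl
  exact eqv_of_enum hd hd' e e' fun i j hij => by rw [he i j hij, he' i j hij]

theorem Chain.rev {U : Type*} {d : U → U → Col} (hd : Skew d) (h : Chain d) : Chain (rev d) := by
  refine ⟨fun x y hxy => by simpa [Lopez.rev] using h.1 x y hxy, fun x y z hxy hyz => ?_⟩
  simp only [Lopez.rev, ← hd.2] at *
  exact h.2 _ _ _ hyz hxy

/-- An enumeration which is reversed by the reversal of the indices, except maybe for the pair of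
its two ends, gives a self-dual pair-colouring. -/
theorem eqv_rev_of_enum {U : Type*} {d : U → U → Col} (hd : Skew d) {n : ℕ} (e : Fin n ≃ U)
    (h : ∀ i j : Fin n, i < j → ¬ (j.val = i.val + (n - 1)) →
      d (e i) (e j) = d (e j.rev) (e i.rev)) :
    Eqv d (rev d) := by
  refine eqv_of_enum hd hd.rev e (Fin.revPerm.trans e) fun i j hij => ?_
  simp only [Lopez.rev, Equiv.trans_apply, Fin.revPerm_apply, ← hd.2]
  by_cases hn : j.val = i.val + (n - 1)
  · have hi : i.rev = j := by ext; simp only [Fin.val_rev]; omega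
    have hj : j.rev = i := by ext; simp only [Fin.val_rev]; omega
    rw [hi, hj]
  · exact h i j hij hn

theorem forall_of_closed {U : Type*} {R : U → U → Prop} (hR : ∀ x y, Relation.ReflTransGen R x y)
    {P : U → Prop} {a : U} (ha : P a) (h : ∀ x y, P x → R x y → P y) (x : U) : P x := by
  induction hR a x with
  | refl => exact ha
  | tail _ hxy ih => exact h _ _ ih hxy

theorem quot_rtg {U : Type*} {R : U → U → Prop} (hs : ∀ x y, R x y → R y x) {x y : U}
    (h : Quot.mk R x = Quot.mk R y) : Relation.ReflTransGen R x y := by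
  have : Std.Symm R := ⟨hs⟩
  have h' := Quot.eqvGen_exact h
  clear h
  induction h' with
  | rel _ _ h => exact .single h
  | refl => exact .refl
  | symm _ _ _ ih => exact Relation.ReflTransGen.stdSymm.symm _ _ ih
  | trans _ _ _ _ _ ih ih' => exact ih.trans ih'

theorem rtg_fibre {U : Type*} {R : U → U → Prop} (hs : ∀ x y, R x y → R y x) {q : Quot R}
    (a b : {x // Quot.mk R x = q}) :
    Relation.ReflTransGen (fun a b : {x // Quot.mk R x = q} => R a b) a b := by
  obtain ⟨a, ha⟩ := a
  obtain ⟨b, hb⟩ := b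
  have h := quot_rtg hs (ha.trans hb.symm)
  induction h with
  | refl => exact .refl
  | @tail x y _ hxy ih => exact (ih ((Quot.sound hxy).trans hb)).tail hxy

theorem quot_const {U : Type*} {R : U → U → Prop} (hs : ∀ x y, R x y → R y x) {c : U → U → Edge}
    (hop : ∀ x y, c y x = (c x y).op)
    (h : ∀ x y z, R y z → Quot.mk R x ≠ Quot.mk R y → c x y = c x z) {x y x' y' : U}
    (hx : Quot.mk R x' = Quot.mk R x) (hy : Quot.mk R y' = Quot.mk R y)
    (hxy : Quot.mk R x ≠ Quot.mk R y) : c x y = c x' y' := by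
  have key : ∀ x y y', Quot.mk R y' = Quot.mk R y → Quot.mk R x ≠ Quot.mk R y →
      c x y = c x y' := by
    intro x y y' hy hxy
    induction quot_rtg hs hy.symm with
    | refl => rfl
    | @tail a b _ hab ih =>
      have hb := Quot.sound hab
      exact (ih (hb.trans hy)).trans (h x a b hab (by rwa [hb, hy]))
  rw [key x y y' hy hxy, hop y' x, hop y' x', key y' x x' hx (by rw [hy]; exact hxy.symm)]

theorem Edge.dir_up (p : Edge) : p.up.dir = p.lo.dir := by cases p <;> rfl

/-- A joint colouring of the pairs satisfying the consequences of hypomorphy on `3` and `4`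
vertices. -/
structure Sys {W : Type*} (c : W → W → Edge) : Prop where
  self : ∀ x, c x x = .void
  op : ∀ x y, c y x = (c x y).op
  h3 : ∀ {x y z}, x ≠ y → x ≠ z → y ≠ z → ok3 (c x y) (c x z) (c y z) = true
  h4 : ∀ {x y z w}, x ≠ y → x ≠ z → x ≠ w → y ≠ z → y ≠ w → z ≠ w →
    ok4 (c x y) (c x z) (c x w) (c y z) (c y w) (c z w) = true

namespace Sys

variable {W : Type*} {c : W → W → Edge}

theorem skew_lo (S : Sys c) : Skew fun x y => (c x y).lo :=
  ⟨fun x => by simp [S.self, Edge.lo], fun x y => by simp [S.op x y]⟩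

theorem skew_up (S : Sys c) : Skew fun x y => (c x y).up :=
  ⟨fun x => by simp [S.self, Edge.up], fun x y => by simp [S.op x y]⟩

theorem comp (S : Sys c) {U : Type*} {f : U → W} (hf : Function.Injective f) :
    Sys fun x y => c (f x) (f y) :=
  ⟨fun _ => S.self _, fun _ _ => S.op _ _, fun h h' h'' => S.h3 (hf.ne h) (hf.ne h') (hf.ne h''),
    fun h₁ h₂ h₃ h₄ h₅ h₆ => S.h4 (hf.ne h₁) (hf.ne h₂) (hf.ne h₃) (hf.ne h₄) (hf.ne h₅)
      (hf.ne h₆)⟩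

theorem ne_of_isH (S : Sys c) {x y : W} (h : (c x y).isH = true) : x ≠ y := by
  rintro rfl
  simp [S.self, Edge.isH] at h

theorem ne_of_isK (S : Sys c) {x y : W} (h : (c x y).isK = true) : x ≠ y := by
  rintro rfl
  simp [S.self, Edge.isK] at h

/-- Being reversed. -/
abbrev H (c : W → W → Edge) (x y : W) : Prop := (c x y).isH = true

/-- Being kept. -/
abbrev K (c : W → W → Edge) (x y : W) : Prop := (c x y).isK = true

theorem H_symm (S : Sys c) (x y : W) (h : H c x y) : H c y x := by simpa [H, S.op x y] using h

theorem K_symm (S : Sys c) (x y : W) (h : K c x y) : K c y x := by simpa [K, S.op x y] using h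

theorem eqv_of_H_fibres (S : Sys c)
    (h : ∀ q : Quot (H c), Eqv (fun x y : {x // Quot.mk (H c) x = q} => (c x y).lo)
      (fun x y : {x // Quot.mk (H c) x = q} => (c x y).up)) :
    Eqv (fun x y => (c x y).lo) (fun x y => (c x y).up) := by
  refine eqv_of_fibres (Quot.mk (H c)) (fun x y x' y' hx hy hxy => ?_) h
  have hH : ∀ {x y}, Quot.mk (H c) x ≠ Quot.mk (H c) y → (c x y).isH = false := fun hxy =>
    Bool.eq_false_iff.2 fun h => hxy (Quot.sound h)
  have := quot_const S.H_symm S.op (fun x y z hyz hxy => ok3_interval _ _ _ hyz (hH hxy)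
    (hH fun h => hxy (h.trans (Quot.sound hyz).symm))
    (S.h3 (fun h => hxy (by rw [h]))
      (fun h => hxy (by rw [h]; exact (Quot.sound hyz).symm)) (S.ne_of_isH hyz))) hx hy hxy
  rw [← this, Edge.up_eq_lo (hH hxy)]

theorem false_of_closed (S : Sys c) {B : Edge → Bool}
    (hB : ∀ x y, Relation.ReflTransGen (fun x y => B (c x y) = true) x y)
    (hop : ∀ p : Edge, B p.op = B p) (hvoid : B .void = false) {x y z : W} (hxy : x ≠ y)
    (hxz : x ≠ z) (hy : B (c x y) = false) (hz : B (c x z) = false)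
    (h : ∀ x' v, x' ≠ y → x' ≠ z → v ≠ x' → v ≠ y → v ≠ z → c x' y = c x y → c x' z = c x z →
      B (c v x') = true → c v y = c x y ∧ c v z = c x z) : False := by
  have := forall_of_closed hB (P := fun v => (v ≠ y ∧ v ≠ z) ∧ c v y = c x y ∧ c v z = c x z)
    (a := x) ⟨⟨hxy, hxz⟩, rfl, rfl⟩ (fun x' v ⟨⟨ha, hb⟩, ha', hb'⟩ hv => by
      have hvy : v ≠ y := by
        rintro rfl
        simp [ha', hy] at hv
      have hvz : v ≠ z := by
        rintro rfl
        simp [hb', hz] at hv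
      have hv' : B (c v x') = true := by rw [S.op x' v, hop, hv]
      have hne : v ≠ x' := by
        rintro rfl
        simp [S.self, hvoid] at hv
      exact ⟨⟨hvy, hvz⟩, h x' v ha hb hne hvy hvz ha' hb' hv'⟩) y
  exact this.1.1 rfl

theorem no_apex (S : Sys c) (hH : ∀ x y, Relation.ReflTransGen (H c) x y) {x a b : W}
    (hxa : x ≠ a) (hxb : x ≠ b) (hab : a ≠ b) : apex (c x a) (c x b) (c a b) = false := by
  by_contra h
  rw [Bool.not_eq_false] at h
  have hn : (c x a).isH = false ∧ (c x b).isH = false := by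
    revert h
    generalize c x a = p
    generalize c x b = q
    generalize c a b = r
    revert p q r
    decide
  refine S.false_of_closed hH Edge.isH_op rfl hxa hxb hn.1 hn.2
    fun x' v ha hb hne hva hvb ha' hb' hv => ?_
  have k3 := S.h3 hne hva ha
  have k3' := S.h3 hne hvb hb
  have k4 := S.h4 hne hva hvb ha hb hab
  rw [ha', hb'] at k4
  rw [ha'] at k3
  rw [hb'] at k3'
  exact apex_closed _ _ _ h _ hv _ k3 _ k3' (S.h3 hva hvb hab) k4

theorem lo3 (S : Sys c) (hH : ∀ x y, Relation.ReflTransGen (H c) x y) {x y z : W}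
    (hxy : x ≠ y) (hxz : x ≠ z) (hyz : y ≠ z) :
    sd3 (c x y).lo (c x z).lo (c y z).lo = true := by
  by_contra h
  rcases apex_of_not_sd3 _ _ _ (S.h3 hxy hxz hyz) (Bool.eq_false_iff.2 h) with h | h | h
  · rw [S.no_apex hH hxy hxz hyz] at h
    cases h
  · rw [← S.op, S.no_apex hH hxy.symm hyz hxz] at h
    cases h
  · rw [← S.op, ← S.op, S.no_apex hH hxz.symm hyz.symm hxy] at h
    cases h

theorem no_diam (S : Sys c) (hH : ∀ x y, Relation.ReflTransGen (H c) x y) {x y z w : W}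
    (hxy : x ≠ y) (hxz : x ≠ z) (hxw : x ≠ w) (hyz : y ≠ z) (hyw : y ≠ w) (hzw : z ≠ w) :
    diam (c x y).lo (c x z).lo (c x w).lo (c y z).lo (c y w).lo (c z w).lo = false := by
  by_contra h
  rw [Bool.not_eq_false] at h
  have h' := h
  simp only [diam, Bool.and_eq_true, beq_iff_eq] at h'
  obtain ⟨⟨⟨⟨⟨-, h1⟩, h2⟩, -⟩, -⟩, -⟩ := h'
  rw [← h2, ← h1] at h
  obtain ⟨hK, hq, hr⟩ := diam_isK _ _ _ _ h _ h1.symm (S.h3 hxy hxz hyz) _ (h2.symm.trans h1.symm)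
    (S.h3 hxy hxw hyw) (S.h3 hxz hxw hzw) (S.h3 hyz hyw hzw) (S.h4 hxy hxz hxw hyz hyw hzw)
  have hn : (c x y).isH = false := by
    revert hK
    generalize c x y = p
    revert p
    decide
  have := forall_of_closed hH (P := fun v => (v ≠ y ∧ v ≠ z ∧ v ≠ w) ∧ c v y = c x y ∧
    c v z = c x y ∧ c v w = c x y) (a := x) ⟨⟨hxy, hxz, hxw⟩, rfl, hq, hr⟩
    (fun x' v ⟨⟨hy, hz, hw⟩, hy', hz', hw'⟩ hv => by
      have hvy : v ≠ y := by
        rintro rfl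
        simp [H, hy', hn] at hv
      have hvz : v ≠ z := by
        rintro rfl
        simp [H, hz', hn] at hv
      have hvw : v ≠ w := by
        rintro rfl
        simp [H, hw', hn] at hv
      have hv' := S.H_symm _ _ hv
      have hne := S.ne_of_isH hv'
      refine ⟨⟨hvy, hvz, hvw⟩, ?_⟩
      have k1 := S.h3 hne hvy hy
      have k2 := S.h3 hne hvz hz
      have k3 := S.h3 hne hvw hw
      have k4 := S.h4 hvy hvz hvw hyz hyw hzw
      rw [hy'] at k1
      rw [hz'] at k2
      rw [hw'] at k3
      exact diam_closed _ _ _ _ hK h (S.h3 hyz hyw hzw) _ hv' _ k1 _ k2 (S.h3 hvy hvz hyz) _ k3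
        (S.h3 hvy hvw hyw) (S.h3 hvz hvw hzw) k4) y
  exact this.1.1 rfl

theorem no_cycle_of_closed (S : Sys c) (hH : ∀ x y, Relation.ReflTransGen (H c) x y)
    {B : Edge → Bool} (hB : ∀ x y, Relation.ReflTransGen (fun x y => B (c x y) = true) x y)
    (hop : ∀ p : Edge, B p.op = B p) (hvoid : B .void = false) {x y z : W} (hxy : x ≠ y)
    (hxz : x ≠ z) (hyz : y ≠ z) (h₁ : (c x y).lo = .fwd) (h₂ : (c x z).lo = .bwd)
    (h₃ : (c y z).lo = .fwd) (hy : B (c x y) = false) (hz : B (c x z) = false)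
    (hsep : ∀ s, B s = true → ((c x y).isH = true ∧ s.isK = true) ∨
      ((c x y).isK = true ∧ s.isH = true)) : False := by
  refine S.false_of_closed hB hop hvoid hxy hxz hy hz
    fun x' v ha hb hne hva hvb ha' hb' hv => ?_
  have hs := hsep _ hv
  rw [← ha'] at h₁ hs ⊢
  rw [← hb'] at h₂ ⊢
  exact cycle_closed _ _ _ h₁ h₂ h₃ (S.h3 ha hb hyz) _ hs _ (S.h3 hne hva ha)
    (S.lo3 hH hne hva ha) _ (S.h3 hne hvb hb) (S.lo3 hH hne hvb hb) (S.h3 hva hvb hyz)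
    (S.lo3 hH hva hvb hyz) (S.no_diam hH hne hva hvb ha hb hyz)

theorem no_neutral_of_closed (S : Sys c) (hH : ∀ x y, Relation.ReflTransGen (H c) x y)
    {B : Edge → Bool} (hB : ∀ x y, Relation.ReflTransGen (fun x y => B (c x y) = true) x y)
    (hop : ∀ p : Edge, B p.op = B p) (hvoid : B .void = false) {x y z : W} (hxy : x ≠ y)
    (hxz : x ≠ z) (hyz : y ≠ z) (h₁ : (c x y).lo.dir = true) (h₂ : (c x z).lo.dir = true)
    (h₃ : (c y z).lo.dir = false) (hy : B (c x y) = false) (hz : B (c x z) = false)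
    (hsep : ∀ s, B s = true → ((c x y).isH = true ∧ s.isK = true) ∨
      ((c x y).isK = true ∧ s.isH = true)) : False := by
  refine S.false_of_closed hB hop hvoid hxy hxz hy hz
    fun x' v ha hb hne hva hvb ha' hb' hv => ?_
  have hs := hsep _ hv
  rw [← ha'] at h₁ hs ⊢
  rw [← hb'] at h₂ ⊢
  exact mid_closed _ _ _ h₁ h₂ h₃ (S.h3 ha hb hyz) (S.lo3 hH ha hb hyz) _ hs _
    (S.h3 hne hva ha) (S.lo3 hH hne hva ha) _ (S.h3 hne hvb hb) (S.lo3 hH hne hvb hb)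
    (S.h3 hva hvb hyz) (S.lo3 hH hva hvb hyz)

theorem isH_false_of_isK {p : Edge} (h : p.isK = true) : p.isH = false := by
  cases p <;> simp_all [Edge.isH, Edge.isK]

theorem isK_false_of_isH {p : Edge} (h : p.isH = true) : p.isK = false := by
  cases p <;> simp_all [Edge.isH, Edge.isK]

theorem dir_of_isH {p : Edge} (h : p.isH = true) : p.lo.dir = true := by
  cases p <;> simp_all [Edge.isH, Edge.lo, Col.dir]

theorem chains (S : Sys c) {U : Type*} {g : U → W} (hg : Function.Injective g)
    (hdir : ∀ x y, x ≠ y → (c (g x) (g y)).lo.dir = true)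
    (hcyc : ∀ x y z, (c (g x) (g y)).lo = .fwd → (c (g x) (g z)).lo = .bwd →
      (c (g y) (g z)).lo = .fwd → False) :
    Chain (fun x y => (c (g x) (g y)).lo) ∧ Chain (fun x y => (c (g x) (g y)).up) := by
  refine ⟨chain_of_no_cycle (S.comp hg).skew_lo hdir fun x y z h h' h'' => hcyc x y z h h'' h',
    chain_of_no_cycle (S.comp hg).skew_up (fun x y hxy => by simpa [Edge.dir_up] using hdir x y hxy)
      fun x y z h h' h'' => ?_⟩
  have hne : ∀ {x y}, (c (g x) (g y)).up.dir = true → g x ≠ g y := by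
    intro x y h e
    rw [e, S.self] at h
    cases h
  rcases up_cycle _ _ _ h h'' h' (S.h3 (hne (by simp [h, Col.dir])) (hne (by simp [h'', Col.dir]))
    (hne (by simp [h', Col.dir]))) with ⟨k, k', k''⟩ | ⟨k, k', k''⟩
  · exact hcyc x y z k k' k''
  · exact hcyc z y x (by simp [S.op (g y) (g z), k'', Col.op])
      (by simp [S.op (g x) (g z), k', Col.op]) (by simp [S.op (g x) (g y), k, Col.op])

theorem eqv_of_K_connected [Finite W] (S : Sys c) (hH : ∀ x y, Relation.ReflTransGen (H c) x y)
    (hK : ∀ x y, Relation.ReflTransGen (K c) x y) :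
    Eqv (fun x y => (c x y).lo) (fun x y => (c x y).up) := by
  have hdir : ∀ x y, x ≠ y → (c x y).lo.dir = true := by
    by_contra! h
    obtain ⟨a, e, hae, hn⟩ := h
    obtain ⟨y, hye, hy, z, hyz⟩ : ∃ y, y ≠ e ∧ (c y e).lo.dir = false ∧
        ∃ z, H c y z ∧ ¬ (z ≠ e ∧ (c z e).lo.dir = false) := by
      by_contra! hcl
      have := forall_of_closed hH (P := fun v => v ≠ e ∧ (c v e).lo.dir = false) (a := a)
        ⟨hae, by simpa using hn⟩ (fun v w hv hvw => hcl v hv.1 hv.2 w hvw) e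
      exact this.1 rfl
    have hze : z ≠ e := by
      rintro rfl
      have := dir_of_isH hyz.1
      rw [hy] at this
      cases this
    have hz : (c z e).lo.dir = true := by simpa [hze] using hyz.2
    have hzy' := S.H_symm _ _ hyz.1
    have hzy := S.ne_of_isH hzy'
    rcases mid_same _ _ _ (dir_of_isH hzy') hz hy (S.h3 hzy hze hye) with h | h
    · exact S.no_neutral_of_closed hH hK Edge.isK_op rfl hzy hze hye (dir_of_isH hzy') hz hy
        (isK_false_of_isH h.1) (isK_false_of_isH h.2) fun s hs => Or.inl ⟨h.1, hs⟩
    · exact S.no_neutral_of_closed hH hH Edge.isH_op rfl hzy hze hye (dir_of_isH hzy') hz hy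
        (isH_false_of_isK h.1) (isH_false_of_isK h.2) fun s hs => Or.inr ⟨h.1, hs⟩
  obtain ⟨h₁, h₂⟩ := S.chains (g := id) Function.injective_id hdir fun x y z k k' k'' => by
    simp only [id] at k k' k''
    have hne : ∀ {x y}, (c x y).lo.dir = true → x ≠ y := by
      rintro x _ h rfl
      rw [S.self] at h
      cases h
    have hxy : x ≠ y := hne (by simp [k, Col.dir])
    have hxz : x ≠ z := hne (by simp [k', Col.dir])
    have hyz : y ≠ z := hne (by simp [k'', Col.dir])
    rcases cycle_same _ _ _ k k' k'' (S.h3 hxy hxz hyz) with h | h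
    · exact S.no_cycle_of_closed hH hK Edge.isK_op rfl hxy hxz hyz k k' k''
        (isK_false_of_isH h.1) (isK_false_of_isH h.2.1) fun s hs => Or.inl ⟨h.1, hs⟩
    · exact S.no_cycle_of_closed hH hH Edge.isH_op rfl hxy hxz hyz k k' k''
        (isH_false_of_isK h.1) (isH_false_of_isK h.2.1) fun s hs => Or.inr ⟨h.1, hs⟩
  exact Chain.eqv S.skew_lo S.skew_up h₁ h₂

theorem K_interval (S : Sys c) (hH : ∀ x y, Relation.ReflTransGen (H c) x y) {x y z : W}
    (hyz : K c y z) (hxy : Quot.mk (K c) x ≠ Quot.mk (K c) y) : c x y = c x z := by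
  have hK : ∀ {x y}, Quot.mk (K c) x ≠ Quot.mk (K c) y → (c x y).isK = false := fun hxy =>
    Bool.eq_false_iff.2 fun h => hxy (Quot.sound h)
  have hxz : Quot.mk (K c) x ≠ Quot.mk (K c) z := by rwa [← Quot.sound hyz]
  have hxy' : x ≠ y := fun h => hxy (by rw [h])
  have hxz' : x ≠ z := fun h => hxz (by rw [h])
  exact sd3_interval _ _ _ hyz (hK hxy) (hK hxz) (S.lo3 hH hxy' hxz' (S.ne_of_isK hyz))
    (S.h3 hxy' hxz' (S.ne_of_isK hyz))

theorem eqv_rev_of_not_K_connected (S : Sys c) (hH : ∀ x y, Relation.ReflTransGen (H c) x y)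
    (hK : ¬ ∀ x y, Relation.ReflTransGen (K c) x y) {U : Type*} [Finite U] {g : U → W}
    (hg : Function.Injective g) :
    Eqv (fun x y => (c (g x) (g y)).up) (rev fun x y => (c (g x) (g y)).lo) := by
  refine eqv_of_fibres (fun x => Quot.mk (K c) (g x)) (fun x y x' y' hx hy hxy => ?_) fun q => ?_
  · rw [quot_const S.K_symm S.op (fun x y z hyz hxy => S.K_interval hH hyz hxy) hx hy hxy]
    refine Edge.up_eq_op_lo (Bool.eq_false_iff.2 fun h => hxy ?_)
    rw [← hx, ← hy]
    exact Quot.sound h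
  · have hconst : ∀ {x y x' y'}, Quot.mk (K c) x' = Quot.mk (K c) x →
        Quot.mk (K c) y' = Quot.mk (K c) y → Quot.mk (K c) x ≠ Quot.mk (K c) y → c x y = c x' y' :=
      fun hx hy hxy => quot_const S.K_symm S.op (fun x y z => S.K_interval hH) hx hy hxy
    rcases isEmpty_or_nonempty {x // Quot.mk (K c) (g x) = q} with he | ⟨⟨a, ha⟩⟩
    · exact ⟨Equiv.refl _, fun x => he.elim x⟩
    obtain ⟨y, z, hyq, hyz, hzq⟩ : ∃ y z, Quot.mk (K c) y = q ∧ H c y z ∧ Quot.mk (K c) z ≠ q := by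
      by_contra! hcl
      have := forall_of_closed hH (P := fun v => Quot.mk (K c) v = q) ha
        fun x y hx hxy => hcl x y hx hxy
      exact hK fun x y => quot_rtg S.K_symm ((this x).trans (this y).symm)
    have hz : ∀ x, Quot.mk (K c) x = q → c z x = c z y := fun x hx =>
      (hconst rfl (hx.trans hyq.symm) (by rwa [hyq])).symm
    have hzy : (c z y).lo.dir = true := dir_of_isH (S.H_symm _ _ hyz)
    have hne : ∀ x, Quot.mk (K c) x = q → z ≠ x := by
      rintro x hx rfl
      exact hzq hx
    have hinj : Function.Injective fun x : {x // Quot.mk (K c) (g x) = q} => g x :=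
      hg.comp Subtype.val_injective
    obtain ⟨h₁, h₂⟩ := S.chains hinj
      (fun x y hxy => by
        have := S.lo3 hH (hne _ x.2) (hne _ y.2) (hinj.ne hxy)
        rw [hz _ x.2, hz _ y.2] at this
        exact peak_not_sd3 _ _ hzy this)
      (fun u v w k k' k'' => by
        have hne' : ∀ {x y}, (c x y).lo.dir = true → x ≠ y := by
          rintro x _ h rfl
          rw [S.self] at h
          cases h
        have := S.no_diam hH (hne _ u.2) (hne _ v.2) (hne _ w.2) (hne' (by simp [k, Col.dir]))
          (hne' (by simp [k', Col.dir])) (hne' (by simp [k'', Col.dir]))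
        simp [hz _ u.2, hz _ v.2, hz _ w.2, k, k', k'', diam, hzy] at this)
    exact Chain.eqv (S.comp hinj).skew_up (S.comp hinj).skew_lo.rev h₂
      (h₁.rev (S.comp hinj).skew_lo)

end Sys

/-- The second-level weights of the vertices of a digraph on `5` vertices, given by its pairs in
lexicographic order. -/
def prof5 (p₁ p₂ p₃ p₄ q₂ q₃ q₄ r₃ r₄ s₄ : Col) : List ℕ :=
  let w₀ := p₁.wt + p₂.wt + p₃.wt + p₄.wt
  let w₁ := p₁.op.wt + q₂.wt + q₃.wt + q₄.wt
  let w₂ := p₂.op.wt + q₂.op.wt + r₃.wt + r₄.wt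
  let w₃ := p₃.op.wt + q₃.op.wt + r₃.op.wt + s₄.wt
  let w₄ := p₄.op.wt + q₄.op.wt + r₄.op.wt + s₄.op.wt
  [p₁.wt₂ w₁ + p₂.wt₂ w₂ + p₃.wt₂ w₃ + p₄.wt₂ w₄,
    p₁.op.wt₂ w₀ + q₂.wt₂ w₂ + q₃.wt₂ w₃ + q₄.wt₂ w₄,
    p₂.op.wt₂ w₀ + q₂.op.wt₂ w₁ + r₃.wt₂ w₃ + r₄.wt₂ w₄,
    p₃.op.wt₂ w₀ + q₃.op.wt₂ w₁ + r₃.op.wt₂ w₂ + s₄.wt₂ w₄,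
    p₄.op.wt₂ w₀ + q₄.op.wt₂ w₁ + r₄.op.wt₂ w₂ + s₄.op.wt₂ w₃]

/-- A consequence of self-duality on `5` vertices. -/
def sd5 (p₁ p₂ p₃ p₄ q₂ q₃ q₄ r₃ r₄ s₄ : Col) : Bool :=
  sub (prof5 p₁ p₂ p₃ p₄ q₂ q₃ q₄ r₃ r₄ s₄)
    (prof5 p₁.op p₂.op p₃.op p₄.op q₂.op q₃.op q₄.op r₃.op r₄.op s₄.op)

theorem ofFn_wsum₂_five {d : Fin 5 → Fin 5 → Col} (hd : Skew d) :
    List.ofFn (wsum₂ d) = prof5 (d 0 1) (d 0 2) (d 0 3) (d 0 4) (d 1 2) (d 1 3) (d 1 4)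
      (d 2 3) (d 2 4) (d 3 4) := by
  simp [prof5, wsum, wsum₂, List.ofFn_succ, Fin.sum_univ_five, hd.1, hd.2 0 1, hd.2 0 2, hd.2 0 3,
    hd.2 0 4, hd.2 1 2, hd.2 1 3, hd.2 1 4, hd.2 2 3, hd.2 2 4, hd.2 3 4, Col.wt, Col.wt₂]

theorem Hyp.sd5 {U : Type*} {d : U → U → Col} (h : Hyp d (Lopez.rev d)) (hd : Skew d)
    {f : Fin 5 → U} (hf : Function.Injective f) :
    sd5 (d (f 0) (f 1)) (d (f 0) (f 2)) (d (f 0) (f 3)) (d (f 0) (f 4))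
      (d (f 1) (f 2)) (d (f 1) (f 3)) (d (f 1) (f 4)) (d (f 2) (f 3))
      (d (f 2) (f 4)) (d (f 3) (f 4)) = true := by
  obtain ⟨e, he⟩ := h 5 (by norm_num) f hf
  have := sub_ofFn e (wsum₂_eq (d := fun i j => d (f i) (f j))
    (d' := fun i j => Lopez.rev d (f i) (f j)) he)
  rwa [ofFn_wsum₂_five (hd.comp f), ofFn_wsum₂_five (hd.rev.comp f)] at this

section

set_option maxRecDepth 100000

theorem claw_of_sd : ∀ p q s : Col, p.dir = true → q.dir = true → s.dir = false →
    sd3 p q s = true → ∀ r : Col, r.dir = true → ∀ t : Col, sd3 p r t = true →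
    ∀ u : Col, sd3 q r u = true → sd3 s t u = true → sd4 p q r s t u = true →
    t.dir = true ∧ u.dir = true := by decide

theorem mixed_of_sd3 : ∀ p q r : Col, p.dir = false → q.dir = false → r.dir = true →
    sd3 p q r = true → p = q := by decide

theorem peak_of_sd3 : ∀ p q r : Col, p.dir = true → q.dir = true → r.dir = false →
    sd3 p q r = true → p.op = q := by decide

theorem diam_of_sd4 : ∀ p : Col, p.dir = true → sd4 p p p .fwd .bwd .fwd = false := by decide

theorem sd6_wheel₂₃ : ∀ p q r s : Col, p.dir = true → q.dir = true → r.dir = true →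
    s.dir = true → sd6 .fwd .fwd .bwd .bwd .bwd p .fwd .fwd .fwd .fwd .fwd .fwd q r s = false := by
  decide

theorem sd6_wheel₃₂ : ∀ p q r s : Col, p.dir = true → q.dir = true → r.dir = true →
    s.dir = true → sd6 .fwd .fwd .fwd .bwd .bwd p q .fwd .fwd r .fwd .fwd .fwd .fwd s = false := by
  decide

theorem sd5_neutral : ∀ n r t : Col, n.dir = false → r.dir = true → t.dir = true →
    sd5 n .fwd .fwd .bwd .bwd .bwd .fwd r t t = false := by
  decide

theorem sd5_triple : ∀ n : Col, n.dir = false → ∀ r s : Col, r.dir = true → s.dir = true →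
    sd4 .bwd .bwd .bwd r r.op s = true →
    sd5 .bwd .bwd .bwd .fwd r r.op n s r r.op = false := by
  decide

end

theorem inj_of_lt {U : Type*} {n : ℕ} {f : Fin n → U} (h : ∀ i j, i < j → f i ≠ f j) :
    Function.Injective f := by
  intro i j hij
  by_contra hne
  rcases lt_or_gt_of_ne hne with hlt | hlt
  · exact h i j hlt hij
  · exact h j i hlt hij.symm

section

variable {U : Type*} {d : U → U → Col}

theorem Skew.ne (hd : Skew d) {x y : U} (h : (d x y).dir = true) : x ≠ y := by
  rintro rfl
  rw [hd.1] at h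
  cases h

theorem Skew.dir_comm (hd : Skew d) (x y : U) : (d y x).dir = (d x y).dir := by
  rw [hd.2 x y, Col.dir_op]

theorem Skew.ne_of_fwd (hd : Skew d) {x y : U} (h : d x y = .fwd) : x ≠ y :=
  hd.ne (by rw [h]; rfl)

theorem Skew.bwd_iff (hd : Skew d) {x y : U} : d x y = .bwd ↔ d y x = .fwd := by
  rw [hd.2 y x]
  cases d y x <;> simp [Col.op]

theorem Skew.fwd_or (hd : Skew d) {x y : U} (h : (d x y).dir = true) :
    d x y = .fwd ∨ d y x = .fwd :=
  (Col.dir_iff.1 h).imp id hd.bwd_iff.1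

theorem Skew.asymm (hd : Skew d) {x y : U} (h : d x y = .fwd) (h' : d y x = .fwd) : False := by
  rw [hd.2 x y, h] at h'
  cases h'

/-- A neutral pair in the neighbourhood of a vertex is joined to the rest of it. -/
theorem claw (hd : Skew d) (h : Hyp d (Lopez.rev d))
    {u x y z : U} (hx : (d u x).dir = true) (hy : (d u y).dir = true)
    (hz : (d u z).dir = true) (hxy : x ≠ y) (hxz : x ≠ z) (hyz : y ≠ z)
    (hn : (d x y).dir = false) : (d x z).dir = true ∧ (d y z).dir = true :=
  have hux := hd.ne hx
  have huy := hd.ne hy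
  have huz := hd.ne hz
  claw_of_sd _ _ _ hx hy hn (h.prof3 hd hd.rev hux huy hxy) _ hz _
    (h.prof3 hd hd.rev hux huz hxz) _ (h.prof3 hd hd.rev huy huz hyz)
    (h.prof3 hd hd.rev hxy hxz hyz) (h.prof4 hd hd.rev hux huy huz hxy hxz hyz)

theorem mixed (hd : Skew d) (h : Hyp d (Lopez.rev d))
    {x y z : U} (hx : z ≠ x) (hy : z ≠ y) (hnx : (d z x).dir = false)
    (hny : (d z y).dir = false) (hxy : (d x y).dir = true) : d z x = d z y :=
  mixed_of_sd3 _ _ _ hnx hny hxy (h.prof3 hd hd.rev hx hy (hd.ne hxy))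

theorem peak (hd : Skew d) (h : Hyp d (Lopez.rev d))
    {u x y : U} (hx : (d u x).dir = true) (hy : (d u y).dir = true) (hxy : x ≠ y)
    (hn : (d x y).dir = false) : d x u = d u y := by
  rw [hd.2 u x]
  exact peak_of_sd3 _ _ _ hx hy hn (h.prof3 hd hd.rev (hd.ne hx) (hd.ne hy) hxy)

theorem no_diamond (hd : Skew d) (h : Hyp d (Lopez.rev d))
    {u x y z : U} (hux : (d u x).dir = true) (huy : d u y = d u x)
    (huz : d u z = d u x) (hxy : d x y = .fwd) (hyz : d y z = .fwd) (hzx : d z x = .fwd) :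
    False := by
  have h4 := h.prof4 hd hd.rev (hd.ne hux) (hd.ne (huy ▸ hux)) (hd.ne (huz ▸ hux))
    (hd.ne_of_fwd hxy) (hd.ne_of_fwd hzx).symm (hd.ne_of_fwd hyz)
  have := diam_of_sd4 _ hux
  change sd4 (d u x) (d u y) (d u z) (d x y) (d x z) (d y z) = true at h4
  rw [huy, huz, hxy, hyz, hd.bwd_iff.2 hzx, this] at h4
  cases h4

theorem no_out_diamond (hd : Skew d) (h : Hyp d (Lopez.rev d))
    {u x y z : U} (hux : d u x = .fwd) (huy : d u y = .fwd)
    (huz : d u z = .fwd) (hxy : d x y = .fwd) (hyz : d y z = .fwd) (hzx : d z x = .fwd) :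
    False :=
  no_diamond hd h (by rw [hux]; rfl) (by rw [hux, huy]) (by rw [hux, huz]) hxy hyz hzx

theorem no_in_diamond (hd : Skew d) (h : Hyp d (Lopez.rev d))
    {u x y z : U} (hux : d x u = .fwd) (huy : d y u = .fwd)
    (huz : d z u = .fwd) (hxy : d x y = .fwd) (hyz : d y z = .fwd) (hzx : d z x = .fwd) :
    False := by
  rw [← hd.bwd_iff] at hux huy huz
  exact no_diamond hd h (by rw [hux]; rfl) (by rw [hux, huy]) (by rw [hux, huz]) hxy hyz hzx

theorem no_wheel₂₃ (hd : Skew d) (h : Hyp d (Lopez.rev d))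
    (hT : ∀ x y, x ≠ y → (d x y).dir = true) {u v₁ v₂ w₁ w₂ w₃ : U}
    (hv : v₁ ≠ v₂) (hw₁₂ : w₁ ≠ w₂) (hw₁₃ : w₁ ≠ w₃) (hw₂₃ : w₂ ≠ w₃)
    (hv₁ : d u v₁ = .fwd) (hv₂ : d u v₂ = .fwd)
    (hw₁ : d w₁ u = .fwd) (hw₂ : d w₂ u = .fwd) (hw₃ : d w₃ u = .fwd)
    (h₁₁ : d v₁ w₁ = .fwd) (h₁₂ : d v₁ w₂ = .fwd) (h₁₃ : d v₁ w₃ = .fwd)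
    (h₂₁ : d v₂ w₁ = .fwd) (h₂₂ : d v₂ w₂ = .fwd) (h₂₃ : d v₂ w₃ = .fwd) : False := by
  have hf : Function.Injective ![u, v₁, v₂, w₁, w₂, w₃] := inj_of_lt <| by
    simp [Fin.forall_fin_succ, hd.ne_of_fwd hv₁, hd.ne_of_fwd hv₂, (hd.ne_of_fwd hw₁).symm,
      (hd.ne_of_fwd hw₂).symm, (hd.ne_of_fwd hw₃).symm, hd.ne_of_fwd h₁₁, hd.ne_of_fwd h₁₂,
      hd.ne_of_fwd h₁₃, hd.ne_of_fwd h₂₁, hd.ne_of_fwd h₂₂, hd.ne_of_fwd h₂₃, *]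
  have h6 := h.sd6 hd hf
  change Lopez.sd6 (d u v₁) (d u v₂) (d u w₁) (d u w₂) (d u w₃) (d v₁ v₂) (d v₁ w₁) (d v₁ w₂)
    (d v₁ w₃) (d v₂ w₁) (d v₂ w₂) (d v₂ w₃) (d w₁ w₂) (d w₁ w₃) (d w₂ w₃) = true at h6
  rw [← hd.bwd_iff] at hw₁ hw₂ hw₃
  rw [hv₁, hv₂, hw₁, hw₂, hw₃, h₁₁, h₁₂, h₁₃, h₂₁, h₂₂, h₂₃,
    sd6_wheel₂₃ _ _ _ _ (hT _ _ hv) (hT _ _ hw₁₂) (hT _ _ hw₁₃) (hT _ _ hw₂₃)] at h6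
  cases h6

theorem no_wheel₃₂ (hd : Skew d) (h : Hyp d (Lopez.rev d))
    (hT : ∀ x y, x ≠ y → (d x y).dir = true) {u v₁ v₂ v₃ w₁ w₂ : U}
    (hv₁₂ : v₁ ≠ v₂) (hv₁₃ : v₁ ≠ v₃) (hv₂₃ : v₂ ≠ v₃) (hw : w₁ ≠ w₂)
    (hv₁ : d u v₁ = .fwd) (hv₂ : d u v₂ = .fwd) (hv₃ : d u v₃ = .fwd)
    (hw₁ : d w₁ u = .fwd) (hw₂ : d w₂ u = .fwd)
    (h₁₁ : d v₁ w₁ = .fwd) (h₁₂ : d v₁ w₂ = .fwd) (h₂₁ : d v₂ w₁ = .fwd)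
    (h₂₂ : d v₂ w₂ = .fwd) (h₃₁ : d v₃ w₁ = .fwd) (h₃₂ : d v₃ w₂ = .fwd) : False := by
  have hf : Function.Injective ![u, v₁, v₂, v₃, w₁, w₂] := inj_of_lt <| by
    simp [Fin.forall_fin_succ, hd.ne_of_fwd hv₁, hd.ne_of_fwd hv₂, (hd.ne_of_fwd hw₁).symm,
      (hd.ne_of_fwd hw₂).symm, hd.ne_of_fwd hv₃, hd.ne_of_fwd h₁₁, hd.ne_of_fwd h₁₂,
      hd.ne_of_fwd h₃₁, hd.ne_of_fwd h₂₁, hd.ne_of_fwd h₂₂, hd.ne_of_fwd h₃₂, *]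
  have h6 := h.sd6 hd hf
  change Lopez.sd6 (d u v₁) (d u v₂) (d u v₃) (d u w₁) (d u w₂) (d v₁ v₂) (d v₁ v₃) (d v₁ w₁)
    (d v₁ w₂) (d v₂ v₃) (d v₂ w₁) (d v₂ w₂) (d v₃ w₁) (d v₃ w₂) (d w₁ w₂) = true at h6
  rw [← hd.bwd_iff] at hw₁ hw₂
  rw [hv₁, hv₂, hv₃, hw₁, hw₂, h₁₁, h₁₂, h₃₁, h₂₁, h₂₂, h₃₂,
    sd6_wheel₃₂ _ _ _ _ (hT _ _ hv₁₂) (hT _ _ hv₁₃) (hT _ _ hv₂₃) (hT _ _ hw)] at h6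
  cases h6

theorem no_neutral_pair (hd : Skew d) (h : Hyp d (Lopez.rev d))
    {a c x x' y : U} (hac : a ≠ c) (hn : (d a c).dir = false) (hxx' : x ≠ x')
    (hT : (d x x').dir = true)
    (hax : d a x = .fwd) (hxc : d x c = .fwd) (hax' : d a x' = .fwd) (hxc' : d x' c = .fwd)
    (hcy : d c y = .fwd) (hya : d y a = .fwd) (hxy : (d x y).dir = true)
    (hxy' : d x' y = d x y) : False := by
  have hf : Function.Injective ![a, c, x, x', y] := inj_of_lt <| by
    simp [Fin.forall_fin_succ, hd.ne_of_fwd hax, (hd.ne_of_fwd hxc).symm, hd.ne_of_fwd hax',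
      (hd.ne_of_fwd hxc').symm, hd.ne_of_fwd hcy, (hd.ne_of_fwd hya).symm, hd.ne hxy, *,
      hd.ne (hxy' ▸ hxy : (d x' y).dir = true)]
  have h5 := h.sd5 hd hf
  change Lopez.sd5 (d a c) (d a x) (d a x') (d a y) (d c x) (d c x') (d c y) (d x x') (d x y)
    (d x' y) = true at h5
  rw [← hd.bwd_iff] at hxc hxc' hya
  rw [hax, hax', hya, hxc, hxc', hcy, hxy', sd5_neutral _ _ _ hn hT hxy] at h5
  cases h5

theorem no_neutral_triple (hd : Skew d) (h : Hyp d (Lopez.rev d))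
    {c x x₁ x₂ y : U} (hx₁₂ : x₁ ≠ x₂) (hn : (d x y).dir = false)
    (hxy : x ≠ y)
    (hc : d x c = .fwd) (hc₁ : d x₁ c = .fwd) (hc₂ : d x₂ c = .fwd) (hcy : d c y = .fwd)
    (h₁ : (d x x₁).dir = true) (h₂ : d x x₂ = (d x x₁).op) (hT : (d x₁ x₂).dir = true)
    (hy₁ : d x₁ y = d x x₁) (hy₂ : d x₂ y = (d x x₁).op) : False := by
  have h₂' : x ≠ x₂ := hd.ne (by simpa [h₂] using h₁)
  have hf : Function.Injective ![c, x, x₁, x₂, y] := inj_of_lt <| by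
    simp [Fin.forall_fin_succ, (hd.ne_of_fwd hc).symm, (hd.ne_of_fwd hc₁).symm,
      (hd.ne_of_fwd hc₂).symm, hd.ne_of_fwd hcy, hd.ne h₁, *,
      hd.ne (hy₁ ▸ h₁ : (d x₁ y).dir = true), hd.ne (by simpa [hy₂] using h₁ : (d x₂ y).dir = true)]
  have h5 := h.sd5 hd hf
  have h4 := h.prof4 hd hd.rev (hd.ne_of_fwd hc).symm (hd.ne_of_fwd hc₁).symm
    (hd.ne_of_fwd hc₂).symm (hd.ne h₁) h₂' hx₁₂
  change Lopez.sd5 (d c x) (d c x₁) (d c x₂) (d c y) (d x x₁) (d x x₂) (d x y) (d x₁ x₂)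
    (d x₁ y) (d x₂ y) = true at h5
  change sd4 (d c x) (d c x₁) (d c x₂) (d x x₁) (d x x₂) (d x₁ x₂) = true at h4
  rw [← hd.bwd_iff] at hc hc₁ hc₂
  rw [hc, hc₁, hc₂, h₂] at h4 h5
  rw [hcy, hy₁, hy₂, sd5_triple _ hn _ _ h₁ hT h4] at h5
  cases h5

end

section

variable {U : Type*} [Finite U] {d : U → U → Col}

/-- If `d` becomes a chain after orienting one pair from the minimum to the maximum, then it is
self-dual. -/
theorem eqv_rev_of_extremes (hd : Skew d) (h : Hyp d (Lopez.rev d)) {a c : U} (hac : a ≠ c)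
    (hx : ∀ x, x ≠ a → x ≠ c → d a x = .fwd ∧ d x c = .fwd) : Eqv d (Lopez.rev d) := by
  classical
  let d₁ : U → U → Col := fun x y =>
    if x = a ∧ y = c then .fwd else if x = c ∧ y = a then .bwd else d x y
  have hd₁ : Skew d₁ := by
    refine ⟨fun x => ?_, fun x y => ?_⟩
    · have h₁ : ¬ (x = a ∧ x = c) := by rintro ⟨rfl, rfl⟩; exact hac rfl
      have h₂ : ¬ (x = c ∧ x = a) := by rintro ⟨rfl, rfl⟩; exact hac rfl
      simp [d₁, h₁, h₂, hd.1]
    · simp only [d₁]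
      by_cases h₁ : x = a ∧ y = c
      · obtain ⟨rfl, rfl⟩ := h₁
        simp [hac.symm, Col.op]
      · by_cases h₂ : x = c ∧ y = a
        · obtain ⟨rfl, rfl⟩ := h₂
          simp [hac.symm, Col.op]
        · simp [h₁, h₂, and_comm, hd.2 x y]
  have hac₁ : d₁ a c = .fwd := by simp [d₁]
  have ha : ∀ x, x ≠ a → d₁ a x = .fwd := by
    intro x hxa
    by_cases hxc : x = c
    · rw [hxc, hac₁]
    · simp [d₁, hxc, hac, (hx x hxa hxc).1]
  have hc : ∀ x, x ≠ c → d₁ x c = .fwd := by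
    intro x hxc
    by_cases hxa : x = a
    · rw [hxa, hac₁]
    · simp [d₁, hxa, hxc, (hx x hxa hxc).2]
  have ha' : ∀ x, d₁ x a ≠ .fwd := fun x hxa => hd₁.asymm (ha x (hd₁.ne_of_fwd hxa)) hxa
  have hc' : ∀ x, d₁ c x ≠ .fwd := fun x hxc => hd₁.asymm (hc x (hd₁.ne_of_fwd hxc).symm) hxc
  have hdd : ∀ x y, x ≠ a → x ≠ c → d₁ x y = d x y := by
    intro x y hxa hxc
    simp [d₁, hxa, hxc]
  have hch : Chain d₁ := by
    refine chain_of_no_cycle hd₁ (fun x y hxy => ?_) fun x y z hxy hyz hzx => ?_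
    · by_cases hxa : x = a
      · subst hxa; rw [ha y hxy.symm]; rfl
      by_cases hxc : x = c
      · subst hxc; rw [hd₁.dir_comm, hc y hxy.symm]; rfl
      by_cases hya : y = a
      · subst hya; rw [hd₁.dir_comm, ha x hxy]; rfl
      by_cases hyc : y = c
      · subst hyc; rw [hc x hxy]; rfl
      rw [hdd x y hxa hxc]
      by_contra hn
      have hax := (hx x hxa hxc).1
      have hay := (hx y hya hyc).1
      have := peak hd h (by rw [hax]; rfl) (by rw [hay]; rfl) hxy (by simpa using hn)
      rw [hay] at this
      exact hd.asymm hax this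
    · rw [hd₁.bwd_iff] at hzx
      have hxa : x ≠ a := by rintro rfl; exact ha' _ hzx
      have hya : y ≠ a := by rintro rfl; exact ha' _ hxy
      have hza : z ≠ a := by rintro rfl; exact ha' _ hyz
      have hxc : x ≠ c := by rintro rfl; exact hc' _ hxy
      have hyc : y ≠ c := by rintro rfl; exact hc' _ hyz
      have hzc : z ≠ c := by rintro rfl; exact hc' _ hzx
      rw [hdd _ _ ‹_› ‹_›] at hxy hyz hzx
      exact no_out_diamond hd h (hx x hxa hxc).1 (hx y hya hyc).1 (hx z hza hzc).1 hxy hyz hzx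
  obtain ⟨e, he⟩ := hch.enum hd₁ rfl
  have key : ∀ i j, i < j → ¬ (j.val = i.val + (Nat.card U - 1)) → d (e i) (e j) = .fwd := by
    intro i j hij hn
    rw [← he i j hij]
    have h₁ : ¬ (e i = a ∧ e j = c) := by
      rintro ⟨hi, hj⟩
      have hi0 : ¬ 0 < i.val := fun h0 => ha' (e ⟨0, by omega⟩) (hi ▸ he ⟨0, by omega⟩ i h0)
      have hj0 : ¬ j.val < Nat.card U - 1 := fun h0 =>
        hc' (e ⟨Nat.card U - 1, by omega⟩) (hj ▸ he j ⟨Nat.card U - 1, by omega⟩ h0)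
      omega
    have h₂ : ¬ (e i = c ∧ e j = a) := by
      rintro ⟨hi, hj⟩
      exact hc' _ (hi ▸ he i j hij)
    simp [d₁, h₁, h₂]
  refine eqv_rev_of_enum hd e fun i j hij hn => ?_
  rw [key i j hij hn, key j.rev i.rev (Fin.rev_lt_rev.2 hij)]
  simp only [Fin.val_rev]
  omega

/-- A self-dual tournament criterion: an arc `c → a` seen by many vertices. -/
theorem eqv_rev_of_four (hd : Skew d) (h : Hyp d (Lopez.rev d))
    (hT : ∀ x y, x ≠ y → (d x y).dir = true) {a c : U} (hca : d c a = .fwd) {S : Finset U}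
    (hS : 4 ≤ S.card) (ha : ∀ x ∈ S, d a x = .fwd) (hc : ∀ x ∈ S, d x c = .fwd) :
    Eqv d (Lopez.rev d) := by
  classical
  refine eqv_rev_of_extremes hd h (hd.ne_of_fwd hca).symm fun y hya hyc => ?_
  obtain ⟨x₁, x₂, x₃, hx₁, hx₂, hx₃, h₁₂, h₁₃, h₂₃⟩ :=
    Finset.two_lt_card_iff.1 (show 2 < S.card by omega)
  rcases hd.fwd_or (hT a y hya.symm) with hay | hya' <;>
    rcases hd.fwd_or (hT y c hyc) with hyc' | hcy
  · exact ⟨hay, hyc'⟩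
  · exfalso
    have hyx : ∀ x ∈ S, d y x = .fwd := fun x hx => by
      have hxy : x ≠ y := by
        rintro rfl
        exact hd.asymm hcy (hc x hx)
      refine (hd.fwd_or (hT x y hxy)).resolve_left fun hxy' => ?_
      exact no_in_diamond hd h hay hxy' hcy (ha x hx) (hc x hx) hca
    exact no_wheel₂₃ hd h hT hya.symm h₁₂ h₁₃ h₂₃ hca hcy (hc _ hx₁) (hc _ hx₂) (hc _ hx₃)
      (ha _ hx₁) (ha _ hx₂) (ha _ hx₃) (hyx _ hx₁) (hyx _ hx₂) (hyx _ hx₃)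
  · exfalso
    have hxy : ∀ x ∈ S, d x y = .fwd := fun x hx => by
      have hxy : x ≠ y := by
        rintro rfl
        exact hd.asymm (ha x hx) hya'
      refine (hd.fwd_or (hT x y hxy)).resolve_right fun hyx' => ?_
      exact no_out_diamond hd h hya' hyx' hyc' (ha x hx) (hc x hx) hca
    exact no_wheel₃₂ hd h hT h₁₂ h₁₃ h₂₃ hyc.symm (ha _ hx₁) (ha _ hx₂) (ha _ hx₃) hca hya'
      (hc _ hx₁) (hxy _ hx₁) (hc _ hx₂) (hxy _ hx₂) (hc _ hx₃) (hxy _ hx₃)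
  · exfalso
    have hxy : ∀ x ∈ S, d x y ≠ .fwd → d y x = .fwd := fun x hx =>
      (hd.fwd_or (hT x y (by rintro rfl; exact hd.asymm (ha x hx) hya'))).resolve_left
    have hcard := S.card_filter_add_card_filter_not (fun x => d x y = .fwd)
    have hW : (S.filter fun x => d x y = .fwd).card ≤ 2 := by
      by_contra hlt
      obtain ⟨x₁, x₂, x₃, hx₁, hx₂, hx₃, h₁₂, h₁₃, h₂₃⟩ := Finset.two_lt_card_iff.1 (not_le.1 hlt)
      simp only [Finset.mem_filter] at hx₁ hx₂ hx₃
      exact no_wheel₃₂ hd h hT h₁₂ h₁₃ h₂₃ hyc.symm (ha _ hx₁.1) (ha _ hx₂.1) (ha _ hx₃.1) hca hya'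
        (hc _ hx₁.1) hx₁.2 (hc _ hx₂.1) hx₂.2 (hc _ hx₃.1) hx₃.2
    have hV : (S.filter fun x => ¬ d x y = .fwd).card ≤ 2 := by
      by_contra hlt
      obtain ⟨x₁, x₂, x₃, hx₁, hx₂, hx₃, h₁₂, h₁₃, h₂₃⟩ := Finset.two_lt_card_iff.1 (not_le.1 hlt)
      simp only [Finset.mem_filter] at hx₁ hx₂ hx₃
      exact no_wheel₂₃ hd h hT hya.symm h₁₂ h₁₃ h₂₃ hca hcy (hc _ hx₁.1) (hc _ hx₂.1) (hc _ hx₃.1)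
        (ha _ hx₁.1) (ha _ hx₂.1) (ha _ hx₃.1) (hxy _ hx₁.1 hx₁.2) (hxy _ hx₂.1 hx₂.2)
        (hxy _ hx₃.1 hx₃.2)
    obtain ⟨w₁, w₂, hw₁, hw₂, hw⟩ := Finset.one_lt_card_iff.1
      (show 1 < (S.filter fun x => d x y = .fwd).card by omega)
    obtain ⟨u₁, u₂, hu₁, hu₂, hu⟩ := Finset.one_lt_card_iff.1
      (show 1 < (S.filter fun x => ¬ d x y = .fwd).card by omega)
    simp only [Finset.mem_filter] at hw₁ hw₂ hu₁ hu₂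
    have huw : ∀ u w, u ∈ S ∧ ¬ d u y = .fwd → w ∈ S ∧ d w y = .fwd → d u w = .fwd := by
      intro u w hu hw
      have huw : u ≠ w := by
        rintro rfl
        exact hu.2 hw.2
      refine (hd.fwd_or (hT u w huw)).resolve_right fun hwu => ?_
      exact no_in_diamond hd h (ha u hu.1) hwu (hxy u hu.1 hu.2) (ha w hw.1) hw.2 hya'
    have hyu₁ := hxy _ hu₁.1 hu₁.2
    have hyu₂ := hxy _ hu₂.1 hu₂.2
    exact no_wheel₃₂ hd h hT (hd.ne_of_fwd (ha _ hu₁.1)) (hd.ne_of_fwd (ha _ hu₂.1)) hu hw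
      hya' hyu₁ hyu₂ hw₁.2 hw₂.2 (ha _ hw₁.1) (ha _ hw₂.1) (huw _ _ hu₁ hw₁) (huw _ _ hu₁ hw₂)
      (huw _ _ hu₂ hw₁) (huw _ _ hu₂ hw₂)

end

section

variable {U : Type*} {d : U → U → Col}

theorem Skew.rev_fwd (hd : Skew d) {x y : U} : Lopez.rev d x y = .fwd ↔ d y x = .fwd := by
  rw [Lopez.rev, ← hd.2]

theorem Hyp.rev (h : Hyp d (Lopez.rev d)) : Hyp (Lopez.rev d) (Lopez.rev (Lopez.rev d)) := by
  intro k hk f hf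
  obtain ⟨e, he⟩ := h k hk f hf
  exact ⟨e, fun x y => congrArg Col.op (he x y)⟩

theorem Eqv.of_rev (h : Eqv (Lopez.rev d) (Lopez.rev (Lopez.rev d))) : Eqv d (Lopez.rev d) := by
  obtain ⟨e, he⟩ := h
  refine ⟨e, fun x y => ?_⟩
  have := congrArg Col.op (he x y)
  simpa [Lopez.rev] using this

theorem eqv_rev_of_outdeg [Finite U] (hd : Skew d) (h : Hyp d (Lopez.rev d))
    (hT : ∀ x y, x ≠ y → (d x y).dir = true) {x y z : U} (hxy : d x y = .fwd) (hyz : d y z = .fwd)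
    (hzx : d z x = .fwd) {v : U} {S : Finset U} (hS : 4 ≤ S.card)
    (hv : ∀ x, x ∈ S ↔ d v x = .fwd) : Eqv d (Lopez.rev d) := by
  classical
  have hex : ∃ a b, d v a = .fwd ∧ d a b = .fwd ∧ d b v = .fwd := by
    by_contra! hno
    have hxv : x ≠ v := by rintro rfl; exact hno _ _ hxy hyz hzx
    have hyv : y ≠ v := by rintro rfl; exact hno _ _ hyz hzx hxy
    have hzv : z ≠ v := by rintro rfl; exact hno _ _ hzx hxy hyz
    have up : ∀ p q, q ≠ v → d v p = .fwd → d p q = .fwd → d v q = .fwd := fun p q hq hp hpq =>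
      (hd.fwd_or (hT q v hq)).resolve_left (hno _ _ hp hpq)
    rcases hd.fwd_or (hT v x hxv.symm) with hx | hx
    · have hy := up x y hyv hx hxy
      exact no_out_diamond hd h hx hy (up y z hzv hy hyz) hxy hyz hzx
    · have down : ∀ p q, p ≠ v → d q v = .fwd → d p q = .fwd → d p v = .fwd :=
        fun p q hp hq hpq =>
          (hd.fwd_or (hT p v hp)).resolve_right fun hvp => hno _ _ hvp hpq hq
      have hz := down z x hzv hx hzx
      exact no_in_diamond hd h hx (down y z hyv hz hyz) hz hxy hyz hzx
  obtain ⟨a, b, hva, hab, hbv⟩ := hex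
  have hA : ∀ p ∈ S, d p b ≠ .fwd → d b p = .fwd := fun p hp => by
    have hpb : p ≠ b := by
      rintro rfl
      exact hd.asymm hbv ((hv _).1 hp)
    exact (hd.fwd_or (hT p b hpb)).resolve_left
  have h₁₂ : ∀ p q, p ∈ S ∧ ¬ d p b = .fwd → q ∈ S ∧ d q b = .fwd → d p q = .fwd := by
    rintro p q ⟨hp, hpb⟩ ⟨hq, hqb⟩
    have hpq : p ≠ q := by
      rintro rfl
      exact hpb hqb
    refine (hd.fwd_or (hT p q hpq)).resolve_right fun hqp => ?_
    exact no_in_diamond hd h ((hv _).1 hp) hqp (hA _ hp hpb) ((hv _).1 hq) hqb hbv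
  have hcard := S.card_filter_add_card_filter_not (fun x => d x b = .fwd)
  have hpos : 0 < (S.filter fun x => d x b = .fwd).card :=
    Finset.card_pos.2 ⟨a, Finset.mem_filter.2 ⟨(hv a).2 hva, hab⟩⟩
  obtain h0 | h1 := Nat.eq_zero_or_pos (S.filter fun x => ¬ d x b = .fwd).card
  · refine eqv_rev_of_four hd h hT hbv
      (show 4 ≤ (S.filter fun x => d x b = .fwd).card by omega) ?_ ?_
    · exact fun p hp => (hv p).1 (Finset.mem_filter.1 hp).1
    · exact fun p hp => (Finset.mem_filter.1 hp).2
  obtain h2 | h2 := le_or_gt (S.filter fun x => d x b = .fwd).card 1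
  · obtain ⟨w, hw⟩ := Finset.card_pos.1 hpos
    rw [Finset.mem_filter] at hw
    refine eqv_rev_of_four (a := b) (c := w) hd h hT hw.2
      (S := insert v (S.filter fun x => ¬ d x b = .fwd)) ?_ ?_ ?_
    · rw [Finset.card_insert_of_notMem]
      · omega
      · rw [Finset.mem_filter, hv, hd.1]
        simp
    · simp only [Finset.mem_insert, Finset.mem_filter]
      rintro p (rfl | hp)
      · exact hbv
      · exact hA p hp.1 hp.2
    · simp only [Finset.mem_insert, Finset.mem_filter]
      rintro p (rfl | hp)
      · exact (hv w).1 hw.1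
      · exact h₁₂ p w hp hw
  exfalso
  obtain h3 | h3 := le_or_gt (S.filter fun x => d x b = .fwd).card 2
  · obtain ⟨w₁, w₂, hw₁, hw₂, hw⟩ := Finset.one_lt_card_iff.1 h2
    obtain ⟨p₁, p₂, hp₁, hp₂, hp⟩ := Finset.one_lt_card_iff.1
      (show 1 < (S.filter fun x => ¬ d x b = .fwd).card by omega)
    simp only [Finset.mem_filter] at hw₁ hw₂ hp₁ hp₂
    exact no_wheel₃₂ hd h hT (hd.ne_of_fwd ((hv _).1 hp₁.1)) (hd.ne_of_fwd ((hv _).1 hp₂.1)) hp hw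
      hbv (hA _ hp₁.1 hp₁.2) (hA _ hp₂.1 hp₂.2) hw₁.2 hw₂.2 ((hv _).1 hw₁.1) ((hv _).1 hw₂.1)
      (h₁₂ _ _ hp₁ hw₁) (h₁₂ _ _ hp₁ hw₂) (h₁₂ _ _ hp₂ hw₁) (h₁₂ _ _ hp₂ hw₂)
  · obtain ⟨w₁, w₂, w₃, hw₁, hw₂, hw₃, hw₁₂, hw₁₃, hw₂₃⟩ := Finset.two_lt_card_iff.1 h3
    obtain ⟨p, hp⟩ := Finset.card_pos.1 h1
    simp only [Finset.mem_filter] at hw₁ hw₂ hw₃ hp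
    exact no_wheel₂₃ hd h hT (hd.ne_of_fwd ((hv _).1 hp.1)) hw₁₂ hw₁₃ hw₂₃ hbv (hA _ hp.1 hp.2)
      hw₁.2 hw₂.2 hw₃.2 ((hv _).1 hw₁.1) ((hv _).1 hw₂.1) ((hv _).1 hw₃.1) (h₁₂ _ _ hp hw₁)
      (h₁₂ _ _ hp hw₂) (h₁₂ _ _ hp hw₃)

end

section

variable {U : Type*} [Finite U] {d : U → U → Col}

theorem eqv_rev_of_tournament (hd : Skew d) (h : Hyp d (Lopez.rev d))
    (hT : ∀ x y, x ≠ y → (d x y).dir = true) (hcard : 7 ≤ Nat.card U) :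
    Eqv d (Lopez.rev d) := by
  classical
  have := Fintype.ofFinite U
  by_cases hch : Chain d
  · exact hch.eqv hd hd.rev (hch.rev hd)
  obtain ⟨x, y, z, hxy, hyz, hzx⟩ : ∃ x y z, d x y = .fwd ∧ d y z = .fwd ∧ d z x = .fwd := by
    by_contra! hno
    exact hch (chain_of_no_cycle hd hT fun x y z hxy hyz hxz =>
      hno x y z hxy hyz (hd.bwd_iff.1 hxz))
  by_cases hout : ∃ v, 4 ≤ (Finset.univ.filter fun x => d v x = .fwd).card
  · obtain ⟨v, hv⟩ := hout
    exact eqv_rev_of_outdeg hd h hT hxy hyz hzx (v := v) hv (by simp)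
  by_cases hin : ∃ v, 4 ≤ (Finset.univ.filter fun x => d x v = .fwd).card
  · obtain ⟨v, hv⟩ := hin
    refine Eqv.of_rev (eqv_rev_of_outdeg hd.rev h.rev (fun x y hxy => ?_) (x := x) (y := z) (z := y)
      (hd.rev_fwd.2 hzx) (hd.rev_fwd.2 hyz) (hd.rev_fwd.2 hxy) (v := v) hv
      (by simp [hd.rev_fwd]))
    simpa [Lopez.rev] using hT x y hxy
  push Not at hout hin
  obtain ⟨v⟩ : Nonempty U := ⟨x⟩
  have hsplit : (Finset.univ.filter fun x => d v x = .fwd).card +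
      (Finset.univ.filter fun x => d x v = .fwd).card + 1 = Nat.card U := by
    rw [Nat.card_eq_fintype_card, ← Finset.card_univ, ← Finset.card_union_of_disjoint,
      ← Finset.card_erase_add_one (Finset.mem_univ v)]
    · congr 2
      ext p
      simp only [Finset.mem_union, Finset.mem_filter, Finset.mem_univ, true_and, Finset.mem_erase,
        and_true]
      refine ⟨?_, fun hp => hd.fwd_or (hT v p (Ne.symm hp))⟩
      rintro (hp | hp)
      · exact (hd.ne_of_fwd hp).symm
      · exact hd.ne_of_fwd hp
    · rw [Finset.disjoint_filter]
      exact fun p _ hp hp' => hd.asymm hp hp'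
  have hout_v := hout v
  have hin_v := hin v
  have hN : ∀ (P : U → Prop) [DecidablePred P], (Finset.univ.filter P).card = 3 →
      (∀ p q r, P p → P q → P r → d p q = .fwd → d q r = .fwd → d r p = .fwd → False) →
      ∃ a₁ a₂ a₃, P a₁ ∧ P a₂ ∧ P a₃ ∧ d a₁ a₂ = .fwd ∧ d a₁ a₃ = .fwd ∧ d a₂ a₃ = .fwd := by
    intro P _ hP hcyc
    have hc : Chain fun p q : {p // P p} => d p q :=
      chain_of_no_cycle (hd.comp _) (fun p q hpq => hT _ _ fun h => hpq (Subtype.ext h))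
        fun p q r hpq hqr hpr => hcyc p q r p.2 q.2 r.2 hpq hqr (hd.bwd_iff.1 hpr)
    obtain ⟨e, he⟩ := hc.enum (hd.comp _) (n := 3)
      (by rw [Nat.card_eq_fintype_card, Fintype.card_subtype, hP])
    exact ⟨e 0, e 1, e 2, (e 0).2, (e 1).2, (e 2).2, he 0 1 (by decide), he 0 2 (by decide),
      he 1 2 (by decide)⟩
  obtain ⟨a₁, a₂, a₃, ha₁, ha₂, ha₃, ha₁₂, ha₁₃, ha₂₃⟩ := hN (fun x => d v x = .fwd) (by omega)
    fun p q r hp hq hr => no_out_diamond hd h hp hq hr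
  obtain ⟨b₁, b₂, b₃, hb₁, hb₂, hb₃, hb₁₂, hb₁₃, hb₂₃⟩ := hN (fun x => d x v = .fwd) (by omega)
    fun p q r hp hq hr => no_in_diamond hd h hp hq hr
  have hout' : ∀ {u p q r s}, p ≠ q → p ≠ r → p ≠ s → q ≠ r → q ≠ s → r ≠ s → d u p = .fwd →
      d u q = .fwd → d u r = .fwd → d u s = .fwd → False := by
    intro u p q r s h₁ h₂ h₃ h₄ h₅ h₆ hp hq hr hs
    refine absurd (Finset.three_lt_card_iff.2 ⟨p, q, r, s, ?_⟩) (hout u).not_ge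
    simp [*]
  have hin' : ∀ {u p q r s}, p ≠ q → p ≠ r → p ≠ s → q ≠ r → q ≠ s → r ≠ s → d p u = .fwd →
      d q u = .fwd → d r u = .fwd → d s u = .fwd → False := by
    intro u p q r s h₁ h₂ h₃ h₄ h₅ h₆ hp hq hr hs
    refine absurd (Finset.three_lt_card_iff.2 ⟨p, q, r, s, ?_⟩) (hin u).not_ge
    simp [*]
  have hab : ∀ {a b}, d v a = .fwd → d b v = .fwd → a ≠ b := by
    rintro a _ ha hb rfl
    exact hd.asymm ha hb
  have hor : ∀ {a b}, d v a = .fwd → d b v = .fwd → d a b = .fwd ∨ d b a = .fwd :=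
    fun ha hb => hd.fwd_or (hT _ _ (hab ha hb))
  have hva : ∀ {a}, d v a = .fwd → v ≠ a := hd.ne_of_fwd
  have hvb : ∀ {b}, d b v = .fwd → v ≠ b := fun hb => (hd.ne_of_fwd hb).symm
  have hb₁a : ∀ {a}, d v a = .fwd → d a b₁ = .fwd := fun ha => (hor ha hb₁).resolve_right <|
    hout' (hvb hb₂) (hvb hb₃) (hva ha) (hd.ne_of_fwd hb₂₃) (hab ha hb₂).symm (hab ha hb₃).symm
      hb₁ hb₁₂ hb₁₃
  have ha₃b : ∀ {b}, d b v = .fwd → d a₃ b = .fwd := fun hb => (hor ha₃ hb).resolve_right <|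
    hin' (hva ha₁) (hva ha₂) (hvb hb) (hd.ne_of_fwd ha₁₂) (hab ha₁ hb) (hab ha₂ hb) ha₃ ha₁₃ ha₂₃
  have ha₁b : ∀ {b}, d b v = .fwd → b₁ ≠ b → d b a₁ = .fwd := fun hb hbb =>
    (hor ha₁ hb).resolve_left <| hout' (hd.ne_of_fwd ha₂₃) (hab ha₂ hb₁) (hab ha₂ hb)
      (hab ha₃ hb₁) (hab ha₃ hb) hbb ha₁₂ ha₁₃ (hb₁a ha₁)
  have hb₂a₁ := ha₁b hb₂ (hd.ne_of_fwd hb₁₂)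
  have hb₃a₁ := ha₁b hb₃ (hd.ne_of_fwd hb₁₃)
  have ha₂b₂ : d a₂ b₂ = .fwd := (hor ha₂ hb₂).resolve_right <|
    hout' (hvb hb₃) (hva ha₁) (hva ha₂) (hab ha₁ hb₃).symm (hab ha₂ hb₃).symm (hd.ne_of_fwd ha₁₂)
      hb₂ hb₂₃ hb₂a₁
  have hb₃a₂ : d b₃ a₂ = .fwd := (hor ha₂ hb₃).resolve_left <|
    hout' (hab ha₃ hb₁) (hab ha₃ hb₂) (hab ha₃ hb₃) (hd.ne_of_fwd hb₁₂) (hd.ne_of_fwd hb₁₃)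
      (hd.ne_of_fwd hb₂₃) ha₂₃ (hb₁a ha₂) ha₂b₂
  have hf : Function.Injective ![a₁, a₂, a₃, v, b₁, b₂, b₃] := inj_of_lt <| by
    simp [Fin.forall_fin_succ, hd.ne_of_fwd ha₁₂, hd.ne_of_fwd ha₁₃, hd.ne_of_fwd ha₂₃,
      hd.ne_of_fwd hb₁₂, hd.ne_of_fwd hb₁₃, hd.ne_of_fwd hb₂₃, (hva ha₁).symm, (hva ha₂).symm,
      (hva ha₃).symm, hvb hb₁, hvb hb₂, hvb hb₃, hab ha₁ hb₁, hab ha₁ hb₂, hab ha₁ hb₃,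
      hab ha₂ hb₁, hab ha₂ hb₂, hab ha₂ hb₃, hab ha₃ hb₁, hab ha₃ hb₂, hab ha₃ hb₃]
  refine eqv_rev_of_enum hd (Equiv.ofBijective _
    (hf.bijective_of_nat_card_le (by rw [Nat.card_fin]; omega))) ?_
  have h₁₁ := hb₁a ha₁
  have h₂₁ := hb₁a ha₂
  have h₃₁ := ha₃b hb₁
  have h₃₂ := ha₃b hb₂
  have h₃₃ := ha₃b hb₃
  rw [← hd.bwd_iff] at hb₂a₁ hb₃a₁ hb₃a₂
  have ha₁' := hd.bwd_iff.2 ha₁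
  have ha₂' := hd.bwd_iff.2 ha₂
  have ha₃' := hd.bwd_iff.2 ha₃
  have hb₁' := hd.bwd_iff.2 hb₁
  have hb₂' := hd.bwd_iff.2 hb₂
  have hb₃' := hd.bwd_iff.2 hb₃
  intro i j hij hn
  fin_cases i <;> fin_cases j <;>
    first
    | exact absurd hij (by decide)
    | exact absurd rfl hn
    | simp [Fin.rev, *]

end

section

variable {U : Type*} {d : U → U → Col}

theorem Col.eq_or_eq_op {p q : Col} (hp : p.dir = true) (hq : q.dir = true) :
    q = p ∨ q = p.op := by
  revert p q
  decide

theorem no_three_neutral_pair (hd : Skew d) (h : Hyp d (Lopez.rev d))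
    (hM : ∀ x y z, x ≠ y → x ≠ z → (d x y).dir = false → (d x z).dir = false → y = z)
    {a c : U} (hac : a ≠ c) (hn : (d a c).dir = false) {S : Finset U} (hS : 3 ≤ S.card)
    (hSa : ∀ x ∈ S, d a x = .fwd) (hSc : ∀ x ∈ S, d x c = .fwd) {y : U}
    (hcy : d c y = .fwd) (hya : d y a = .fwd) : False := by
  have hT : ∀ x ∈ S, ∀ x' ∈ S, x ≠ x' → (d x x').dir = true := by
    intro x hx x' hx' hne
    by_contra hxx
    have := peak hd h (by rw [hSa x hx]; rfl) (by rw [hSa x' hx']; rfl) hne (by simpa using hxx)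
    rw [hSa x' hx'] at this
    exact hd.asymm (hSa x hx) this
  have hSy : ∀ x ∈ S, x ≠ y := by
    rintro x hx rfl
    exact hd.asymm (hSa _ hx) hya
  have h2 : ∀ x ∈ S, ∀ x' ∈ S, x ≠ x' → (d x y).dir = true → d x' y ≠ d x y :=
    fun x hx x' hx' hne hxy hxy' => no_neutral_pair hd h hac hn hne (hT x hx x' hx' hne)
      (hSa x hx) (hSc x hx) (hSa x' hx') (hSc x' hx') hcy hya hxy hxy'
  by_cases hall : ∀ x ∈ S, (d x y).dir = true
  · obtain ⟨x₁, x₂, x₃, hx₁, hx₂, hx₃, h₁₂, h₁₃, h₂₃⟩ := Finset.two_lt_card_iff.1 hS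
    have e₂ := (Col.eq_or_eq_op (hall _ hx₁) (hall _ hx₂)).resolve_left
      (h2 _ hx₁ _ hx₂ h₁₂ (hall _ hx₁))
    have e₃ := (Col.eq_or_eq_op (hall _ hx₁) (hall _ hx₃)).resolve_left
      (h2 _ hx₁ _ hx₃ h₁₃ (hall _ hx₁))
    exact h2 _ hx₂ _ hx₃ h₂₃ (hall _ hx₂) (by rw [e₂, e₃])
  · classical
    push Not at hall
    obtain ⟨x, hx, hxy⟩ := hall
    replace hxy := Bool.eq_false_of_not_eq_true hxy
    have hc := Finset.card_erase_add_one hx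
    obtain ⟨x₁, x₂, hx₁, hx₂, h₁₂⟩ := Finset.one_lt_card_iff.1
      (show 1 < (S.erase x).card by omega)
    rw [Finset.mem_erase] at hx₁ hx₂
    have hdy : ∀ x' ∈ S, x' ≠ x → (d x' y).dir = true := fun x' hx' hne => by
      by_contra hn'
      refine hne (hM y x' x (hSy _ hx').symm (hSy _ hx).symm ?_ ?_)
      · rw [hd.dir_comm]; simpa using hn'
      · rw [hd.dir_comm, hxy]
    have hy₁ := hdy _ hx₁.2 hx₁.1
    have hy₂ := hdy _ hx₂.2 hx₂.1
    have hxx₁ := hT _ hx₁.2 _ hx hx₁.1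
    have hxx₂ := hT _ hx₂.2 _ hx hx₂.1
    have p₁ := peak hd h hxx₁ hy₁ (hSy _ hx) hxy
    have p₂ := peak hd h hxx₂ hy₂ (hSy _ hx) hxy
    have e₂ := (Col.eq_or_eq_op hy₁ hy₂).resolve_left (h2 _ hx₁.2 _ hx₂.2 h₁₂ hy₁)
    exact no_neutral_triple hd h h₁₂ hxy (hSy _ hx) (hSc _ hx) (hSc _ hx₁.2) (hSc _ hx₂.2) hcy
      (by rw [p₁]; exact hy₁) (by rw [p₂, e₂, p₁]) (hT _ hx₁.2 _ hx₂.2 h₁₂) p₁.symm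
      (by rw [e₂, p₁])

theorem eqv_rev_of_neutral_pair [Finite U] (hd : Skew d) (h : Hyp d (Lopez.rev d))
    (hcard : 7 ≤ Nat.card U)
    (hM : ∀ x y z, x ≠ y → x ≠ z → (d x y).dir = false → (d x z).dir = false → y = z)
    {a c : U} (hac : a ≠ c) (hn : (d a c).dir = false) : Eqv d (Lopez.rev d) := by
  classical
  have := Fintype.ofFinite U
  have hn' : (d c a).dir = false := by rw [hd.dir_comm, hn]
  have hXY : ∀ p, p ≠ a → p ≠ c →
      (d a p = .fwd ∧ d p c = .fwd) ∨ (d c p = .fwd ∧ d p a = .fwd) := by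
    intro p hpa hpc
    have ha : (d p a).dir = true := by
      by_contra hpa'
      rw [hd.dir_comm, Bool.not_eq_true] at hpa'
      exact hpc (hM a p c hpa.symm hac hpa' hn)
    have hc : (d p c).dir = true := by
      by_contra hpc'
      rw [hd.dir_comm, Bool.not_eq_true] at hpc'
      exact hpa (hM c p a hpc.symm hac.symm hpc' hn')
    have := peak hd h ha hc hac hn
    rcases hd.fwd_or ha with hpa | hap
    · right
      rw [← hd.bwd_iff] at hpa
      rw [hpa] at this
      exact ⟨hd.bwd_iff.1 this.symm, hd.bwd_iff.1 hpa⟩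
    · exact Or.inl ⟨hap, by rw [← this, hap]⟩
  by_cases hX : ∀ x, x ≠ a → x ≠ c → d a x = .fwd ∧ d x c = .fwd
  · exact eqv_rev_of_extremes hd h hac hX
  by_cases hY : ∀ x, x ≠ c → x ≠ a → d c x = .fwd ∧ d x a = .fwd
  · exact eqv_rev_of_extremes hd h hac.symm hY
  exfalso
  push Not at hX hY
  obtain ⟨y, hya, hyc, hy⟩ := hX
  obtain ⟨x, hxc, hxa, hx⟩ := hY
  have hy := (hXY y hya hyc).resolve_left fun h => hy h.1 h.2
  have hx := (hXY x hxa hxc).resolve_right fun h => hx h.1 h.2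
  let R := (Finset.univ.erase a).erase c
  have hR : R.card + 2 = Nat.card U := by
    rw [Nat.card_eq_fintype_card, ← Finset.card_univ,
      ← Finset.card_erase_add_one (Finset.mem_univ a),
      ← Finset.card_erase_add_one (Finset.mem_erase.2 ⟨hac.symm, Finset.mem_univ c⟩)]
  have hsplit := R.card_filter_add_card_filter_not fun p => d a p = .fwd ∧ d p c = .fwd
  obtain h3 | h3 : 3 ≤ (R.filter fun p => d a p = .fwd ∧ d p c = .fwd).card ∨
      3 ≤ (R.filter fun p => ¬ (d a p = .fwd ∧ d p c = .fwd)).card := by omega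
  · refine no_three_neutral_pair hd h hM hac hn h3 ?_ ?_ hy.1 hy.2
    · exact fun p hp => (Finset.mem_filter.1 hp).2.1
    · exact fun p hp => (Finset.mem_filter.1 hp).2.2
  · have key : ∀ p ∈ (R.filter fun p => ¬ (d a p = .fwd ∧ d p c = .fwd)),
        d c p = .fwd ∧ d p a = .fwd := by
      intro p hp
      simp only [R, Finset.mem_filter, Finset.mem_erase] at hp
      exact (hXY p hp.1.2.1 hp.1.1).resolve_left hp.2
    exact no_three_neutral_pair hd h hM hac.symm hn' h3 (fun p hp => (key p hp).1)
      (fun p hp => (key p hp).2) hx.1 hx.2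

end

section

variable {V : Type*} {G : SimpleGraph V}

theorem exists_induced_path₄ (hG : ∀ x y, Relation.ReflTransGen G.Adj x y)
    (hcl : ∀ u x y z, G.Adj u x → G.Adj u y → G.Adj u z → x ≠ y → x ≠ z → y ≠ z → ¬ G.Adj x y →
      G.Adj x z ∧ G.Adj y z)
    {x y z : V} (hxy : x ≠ y) (hxz : x ≠ z) (hyz : y ≠ z) (hnxy : ¬ G.Adj x y)
    (hnxz : ¬ G.Adj x z) :
    ∃ a b c e, G.Adj a b ∧ G.Adj b c ∧ G.Adj c e ∧ ¬ G.Adj a c ∧ ¬ G.Adj a e ∧ ¬ G.Adj b e ∧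
      a ≠ c ∧ a ≠ e ∧ b ≠ e := by
  by_contra! hno
  have hno' : ∀ a b c e, G.Adj a b → G.Adj b c → G.Adj c e → ¬ G.Adj a c → ¬ G.Adj a e →
      ¬ G.Adj b e → a ≠ e → False := by
    intro a b c e hab hbc hce hac hae hbe hne
    obtain rfl := hno a b c e hab hbc hce hac hae hbe (fun h => hae (h ▸ hce)) hne
    exact hae hab
  have hR : ∀ x y, x = y ∨ G.Adj x y ∨ ∃ u, G.Adj u x ∧ G.Adj u y := by
    intro x
    refine forall_of_closed hG (a := x) (Or.inl rfl) ?_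
    rintro y z (rfl | hxy | ⟨u, hux, huy⟩) hyz
    · exact Or.inr (Or.inl hyz)
    · exact Or.inr (Or.inr ⟨y, hxy.symm, hyz⟩)
    · by_cases hxz : x = z
      · exact Or.inl hxz
      by_cases hxz' : G.Adj x z
      · exact Or.inr (Or.inl hxz')
      by_cases huz : G.Adj u z
      · exact Or.inr (Or.inr ⟨u, hux, huz⟩)
      by_cases hxy : G.Adj x y
      · exact Or.inr (Or.inr ⟨y, hxy.symm, hyz⟩)
      exact (hno' x u y z hux.symm huy hyz hxy hxz' huz hxz).elim
  obtain ⟨u, hux, huy⟩ := ((hR x y).resolve_left hxy).resolve_left hnxy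
  have huz : ¬ G.Adj u z := fun huz => hnxz (hcl u x y z hux huy huz hxy hxz hyz hnxy).1
  have hnyz : ¬ G.Adj y z := fun hyz => hno' x u y z hux.symm huy hyz hnxy hnxz huz hxz
  obtain ⟨w, hwz, hwu⟩ := ((hR z u).resolve_left fun h => hnxz (h ▸ hux.symm)).resolve_left
    fun h => huz h.symm
  have hwx : G.Adj w x := by
    by_contra hwx
    exact hno' z w u x hwz.symm hwu hux (fun h => huz h.symm) (fun h => hnxz h.symm) hwx hxz.symm
  have hwy : G.Adj w y := by
    by_contra hwy
    exact hno' z w u y hwz.symm hwu huy (fun h => huz h.symm) (fun h => hnyz h.symm) hwy hyz.symm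
  exact hnxz (hcl w x y z hwx hwy hwz hxy hxz hyz hnxy).1

/-- An induced path on the first `m + 1` terms of `p`. -/
def IndPath (G : SimpleGraph V) (p : ℕ → V) (m : ℕ) : Prop :=
  ∀ i j, i < j → j ≤ m → p i ≠ p j ∧ (G.Adj (p i) (p j) ↔ j = i + 1)

/-- An induced path or an induced cycle on the first `m + 1` terms of `p`. -/
def IndCycle (G : SimpleGraph V) (p : ℕ → V) (m : ℕ) : Prop :=
  ∀ i j, i < j → j ≤ m → p i ≠ p j ∧ (¬ (i = 0 ∧ j = m) → (G.Adj (p i) (p j) ↔ j = i + 1))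

theorem IndPath.reverse {p : ℕ → V} {m : ℕ} (hp : IndPath G p m) :
    IndPath G (fun i => p (m - i)) m := by
  intro i j hij hj
  obtain ⟨h₁, h₂⟩ := hp (m - j) (m - i) (by omega) (by omega)
  refine ⟨h₁.symm, ?_⟩
  rw [G.adj_comm, h₂]
  omega

theorem IndPath.cons {p : ℕ → V} {m : ℕ} (hp : IndPath G p m) {v : V} (hv : ∀ i ≤ m, v ≠ p i)
    (h : ∀ i ≤ m, G.Adj v (p i) ↔ i = 0) : IndPath G (fun i => i.casesOn v p) (m + 1) := by
  rintro (_ | i) (_ | j) hij hj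
  · omega
  · refine ⟨hv j (by omega), ?_⟩
    change G.Adj v (p j) ↔ _
    rw [h j (by omega)]
    omega
  · omega
  · obtain ⟨h₁, h₂⟩ := hp i j (by omega) (by omega)
    refine ⟨h₁, ?_⟩
    change G.Adj (p i) (p j) ↔ _
    rw [h₂]
    omega

theorem exists_maximal_indPath [Finite V] {p : ℕ → V} {k : ℕ} (hp : IndPath G p k) :
    ∃ p m, k ≤ m ∧ IndPath G p m ∧ ∀ p', ¬ IndPath G p' (m + 1) := by
  by_contra! hno
  have hall : ∀ m, k ≤ m → ∃ p, IndPath G p m := by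
    intro m hm
    induction m, hm using Nat.le_induction with
    | base => exact ⟨p, hp⟩
    | succ m hm ih =>
      obtain ⟨p, hp⟩ := ih
      exact hno p m hm hp
  obtain ⟨q, hq⟩ := hall (max k (Nat.card V)) (le_max_left _ _)
  have hinj : Function.Injective fun i : Fin (Nat.card V + 1) => q i :=
    inj_of_lt fun i j hij => (hq i j hij (by omega)).1
  have := Nat.card_le_card_of_injective _ hinj
  rw [Nat.card_fin] at this
  omega

theorem exists_indCycle [Finite V] (hG : ∀ x y, Relation.ReflTransGen G.Adj x y)
    (hcl : ∀ u x y z, G.Adj u x → G.Adj u y → G.Adj u z → x ≠ y → x ≠ z → y ≠ z → ¬ G.Adj x y →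
      G.Adj x z ∧ G.Adj y z)
    {x y z : V} (hxy : x ≠ y) (hxz : x ≠ z) (hyz : y ≠ z) (hnxy : ¬ G.Adj x y)
    (hnxz : ¬ G.Adj x z) :
    ∃ p m, IndCycle G p m ∧ ∀ x, ∃ i ≤ m, x = p i := by
  obtain ⟨a, b, c, e, hab, hbc, hce, hac, hae, hbe, hac', hae', hbe'⟩ :=
    exists_induced_path₄ hG hcl hxy hxz hyz hnxy hnxz
  have h3 : IndPath G (fun i => if i = 0 then a else if i = 1 then b else if i = 2 then c else e)
      3 := by
    intro i j hij hj
    interval_cases j <;> interval_cases i <;>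
      simp [hab, hbc, hce, hac, hae, hbe, hac', hae', hbe', hab.ne, hbc.ne, hce.ne]
  obtain ⟨p, m, hm, hp, hmax⟩ := exists_maximal_indPath h3
  have interior : ∀ v, (∀ i ≤ m, v ≠ p i) → ∀ i, 1 ≤ i → i < m → ¬ G.Adj v (p i) := by
    intro v hv
    have step : ∀ i, 1 ≤ i → i < m → G.Adj v (p i) →
        G.Adj (p (i - 1)) v ∧ G.Adj (p (i + 1)) v := by
      intro i hi him hvi
      refine hcl (p i) _ _ v ?_ ?_ hvi.symm (hp _ _ (by omega) (by omega)).1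
        (hv _ (by omega)).symm (hv _ (by omega)).symm ?_
      · exact ((hp (i - 1) i (by omega) (by omega)).2.2 (by omega)).symm
      · exact (hp i (i + 1) (by omega) (by omega)).2.2 rfl
      · rw [(hp _ _ (by omega) (by omega)).2]
        omega
    have one : ¬ G.Adj v (p 1) := by
      intro hv1
      obtain ⟨h0, h2⟩ := step 1 le_rfl (by omega) hv1
      obtain ⟨-, h3⟩ := step 2 (by omega) (by omega) h2.symm
      have h02 := hp 0 2 (by omega) (by omega)
      have h03 := hp 0 3 (by omega) (by omega)
      have h23 := hp 2 3 (by omega) (by omega)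
      have := (hcl v (p 0) (p 2) (p 3) h0.symm h2.symm h3.symm h02.1 h03.1 h23.1
        (by rw [h02.2]; omega)).1
      rw [h03.2] at this
      omega
    intro i hi
    induction i, hi using Nat.le_induction with
    | base => exact fun _ => one
    | succ i hi ih => exact fun him hv' => ih (by omega) (step _ (by omega) him hv').1.symm
  have ends : ∀ p, IndPath G p m → (∀ v, (∀ i ≤ m, v ≠ p i) → ∀ i, 1 ≤ i → i < m →
      ¬ G.Adj v (p i)) → ∀ v, (∀ i ≤ m, v ≠ p i) → G.Adj v (p 0) → G.Adj v (p m) := by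
    intro p hp hmid v hv hv0
    by_contra hvm
    refine hmax _ (hp.cons hv fun i hi => ⟨fun hvi => ?_, by rintro rfl; exact hv0⟩)
    by_contra hi0
    obtain rfl | hlt := hi.eq_or_lt
    · exact hvm hvi
    · exact hmid v hv i (by omega) hlt hvi
  have ends₁ := ends p hp interior
  have ends₂ : ∀ v, (∀ i ≤ m, v ≠ p i) → G.Adj v (p m) → G.Adj v (p 0) := by
    intro v hv hvm
    have := ends _ hp.reverse (fun v hv i hi him => interior v (fun j hj => ?_) _ (by omega)
      (by omega)) v (fun i hi => hv _ (by omega)) (by simpa using hvm)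
    · simpa using this
    · have := hv (m - j) (by omega)
      rwa [show m - (m - j) = j by omega] at this
  by_cases hout : ∃ v, (∀ i ≤ m, v ≠ p i) ∧ ∃ i ≤ m, G.Adj v (p i)
  · obtain ⟨v, hv, i, hi, hvi⟩ := hout
    have hv0 : G.Adj v (p 0) := by
      obtain rfl | hi0 := Nat.eq_zero_or_pos i
      · exact hvi
      obtain rfl | hlt := hi.eq_or_lt
      · exact ends₂ v hv hvi
      · exact absurd hvi (interior v hv i hi0 hlt)
    have hvm := ends₁ v hv hv0
    have hw0 : ∀ w, w ≠ v → (∀ i ≤ m, w ≠ p i) → ¬ G.Adj w (p 0) := by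
      intro w hwv hw hw0
      refine interior w hw 1 le_rfl (by omega) (hcl (p 0) v (p 1) w hv0.symm ?_ hw0.symm
        (hv 1 (by omega)) hwv.symm (hw 1 (by omega)).symm
        (interior v hv 1 le_rfl (by omega))).2.symm
      exact (hp 0 1 (by omega) (by omega)).2.2 rfl
    refine ⟨fun i => if i ≤ m then p i else v, m + 1, fun i j hij hj => ?_, ?_⟩
    · have him : i ≤ m := by omega
      by_cases hjm : j ≤ m
      · simp only [him, hjm, if_true]
        exact ⟨(hp i j hij hjm).1, fun _ => (hp i j hij hjm).2⟩
      · obtain rfl : j = m + 1 := by omega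
        simp only [him, hjm, if_true, if_false]
        refine ⟨(hv i him).symm, fun hi0 => ?_⟩
        obtain rfl | hlt := him.eq_or_lt
        · simpa using hvm.symm
        · have hi0 : i ≠ 0 := by simpa using hi0
          have := interior v hv i (by omega) hlt
          rw [G.adj_comm]
          simp only [this, false_iff]
          omega
    · have hall : ∀ x, x = v ∨ ∃ i ≤ m, x = p i := by
        refine forall_of_closed hG (a := v) (Or.inl rfl) fun x w hx hxw => ?_
        by_contra! hw
        obtain ⟨hwv, hw⟩ := hw
        rcases hx with rfl | ⟨i, hi, rfl⟩
        · have h0m := hp 0 m (by omega) le_rfl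
          refine hw0 w hwv hw (hcl x (p 0) (p m) w hv0 hvm hxw h0m.1 (hw 0 (by omega)).symm
            (hw m le_rfl).symm ?_).1.symm
          rw [h0m.2]
          omega
        · obtain rfl | hi0 := Nat.eq_zero_or_pos i
          · exact hw0 w hwv hw hxw.symm
          obtain rfl | hlt := hi.eq_or_lt
          · exact hw0 w hwv hw (ends₂ w hw hxw.symm)
          · exact interior w hw i hi0 hlt hxw.symm
      intro x
      rcases hall x with rfl | ⟨i, hi, rfl⟩
      · exact ⟨m + 1, le_rfl, by simp⟩
      · exact ⟨i, by omega, by simp [hi]⟩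
  · refine ⟨p, m, fun i j hij hj => ⟨(hp i j hij hj).1, fun _ => (hp i j hij hj).2⟩, ?_⟩
    refine forall_of_closed hG (a := p 0) ⟨0, by omega, rfl⟩ ?_
    rintro x w ⟨i, hi, rfl⟩ hxw
    by_contra! hw
    exact hout ⟨w, hw, i, hi, hxw.symm⟩

end

section

variable {U : Type*} {d : U → U → Col}

theorem eqv_rev_of_indCycle (hd : Skew d) (h : Hyp d (Lopez.rev d)) (hcard : 7 ≤ Nat.card U)
    {p : ℕ → U} {m : ℕ} (hne : ∀ i j, i < j → j ≤ m → p i ≠ p j)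
    (hp : ∀ i j, i < j → j ≤ m → ¬ (i = 0 ∧ j = m) → ((d (p i) (p j)).dir = true ↔ j = i + 1))
    (hsurj : ∀ x, ∃ i ≤ m, x = p i) : Eqv d (Lopez.rev d) := by
  have hbij : Function.Bijective fun i : Fin (m + 1) => p i := by
    refine ⟨inj_of_lt fun i j hij => hne i j hij (by omega), fun x => ?_⟩
    obtain ⟨i, hi, rfl⟩ := hsurj x
    exact ⟨⟨i, by omega⟩, rfl⟩
  have hm : Nat.card U = m + 1 := by rw [← Nat.card_eq_of_bijective _ hbij, Nat.card_fin]
  have hdir : ∀ i, i + 1 ≤ m → (d (p i) (p (i + 1))).dir = true := fun i hi =>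
    (hp i (i + 1) (by omega) hi (by omega)).2 rfl
  have hneu : ∀ i j, i + 2 ≤ j → j ≤ m → ¬ (i = 0 ∧ j = m) → (d (p i) (p j)).dir = false := by
    intro i j hij hj hn
    rw [← Bool.not_eq_true, hp i j (by omega) hj hn]
    omega
  have harc : ∀ i, i + 1 ≤ m → d (p i) (p (i + 1)) = d (p 0) (p 1) := by
    intro i
    induction i with
    | zero => exact fun _ => rfl
    | succ i ih =>
      intro hi
      rw [← ih (by omega)]
      refine (peak hd h ?_ (hdir _ hi) (hne _ _ (by omega) hi)
        (hneu i (i + 2) le_rfl hi (by omega))).symm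
      rw [hd.dir_comm]
      exact hdir i (by omega)
  have hcomm : ∀ {x y}, (d x y).dir = false → d y x = d x y := by
    intro x y hxy
    rw [hd.2 x y]
    revert hxy
    cases d x y <;> simp [Col.op, Col.dir]
  have hstep : ∀ i j, i + 2 ≤ j → j + 1 ≤ m → ¬ (i = 0 ∧ j + 1 = m) →
      d (p i) (p (j + 1)) = d (p i) (p j) := fun i j hij hj hn =>
    (mixed hd h (hne _ _ (by omega) (by omega)) (hne _ _ (by omega) hj)
      (hneu i j hij (by omega) (by omega)) (hneu i (j + 1) (by omega) hj hn) (hdir j hj)).symm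
  have hshort : ∀ i, i + 2 ≤ m → d (p i) (p (i + 2)) = d (p 0) (p 2) := by
    intro i
    induction i with
    | zero => exact fun _ => rfl
    | succ i ih =>
      intro hi
      have h₁ := hneu i (i + 3) (by omega) hi (by omega)
      have h₂ := hneu (i + 1) (i + 3) (by omega) hi (by omega)
      rw [← ih (by omega), ← hstep i (i + 2) le_rfl hi (by omega), ← hcomm h₁, ← hcomm h₂]
      exact (mixed hd h (hne _ _ (by omega) hi).symm (hne _ _ (by omega) hi).symm
        (by rw [hd.dir_comm, h₁]) (by rw [hd.dir_comm, h₂]) (hdir i (by omega))).symm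
  have hlong : ∀ i j, i + 2 ≤ j → j ≤ m → ¬ (i = 0 ∧ j = m) →
      d (p i) (p j) = d (p 0) (p 2) := by
    intro i j hij
    induction j, hij using Nat.le_induction with
    | base => exact fun hi _ => hshort i hi
    | succ j hj ih =>
      intro hjm hn
      rw [hstep i j hj hjm hn, ih (by omega) (by omega)]
  refine eqv_rev_of_enum hd (Equiv.ofBijective _ hbij) fun i j hij hn => ?_
  have hij' : i.val < j.val := hij
  have hi := i.2
  have hj := j.2
  simp only [Equiv.ofBijective_apply, Fin.val_rev]
  by_cases hji : j.val = i.val + 1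
  · rw [hji, show m + 1 - (i.val + 1) = m + 1 - (i.val + 1 + 1) + 1 by omega,
      harc i.val (by omega), harc (m + 1 - (i.val + 1 + 1)) (by omega)]
  · exact (hlong i.val j.val (by omega) (by omega) (by omega)).trans
      (hlong (m + 1 - (j.val + 1)) (m + 1 - (i.val + 1)) (by omega) (by omega) (by omega)).symm

/-- A connected pair-colouring on at least `7` vertices whose restrictions to at most `6` vertices
are self-dual is self-dual. -/
theorem eqv_rev [Finite U] (hd : Skew d) (h : Hyp d (Lopez.rev d)) (hcard : 7 ≤ Nat.card U)
    (hconn : ∀ x y, Relation.ReflTransGen (fun x y => (d x y).dir = true) x y) :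
    Eqv d (Lopez.rev d) := by
  by_cases hM : ∀ x y z, x ≠ y → x ≠ z → (d x y).dir = false → (d x z).dir = false → y = z
  · by_cases hT : ∀ x y, x ≠ y → (d x y).dir = true
    · exact eqv_rev_of_tournament hd h hT hcard
    · push Not at hT
      obtain ⟨a, c, hac, hn⟩ := hT
      exact eqv_rev_of_neutral_pair hd h hcard hM hac (Bool.eq_false_of_not_eq_true hn)
  · push Not at hM
    obtain ⟨x, y, z, hxy, hxz, hnxy, hnxz, hyz⟩ := hM
    let G : SimpleGraph U :=
      { Adj := fun x y => (d x y).dir = true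
        symm := ⟨fun x y hxy => by rw [hd.dir_comm]; exact hxy⟩
        loopless := ⟨fun x hx => hd.ne hx rfl⟩ }
    obtain ⟨p, m, hp, hsurj⟩ := exists_indCycle (G := G) hconn
      (fun u x y z hx hy hz hxy hxz hyz hn =>
        claw hd h hx hy hz hxy hxz hyz (Bool.eq_false_of_not_eq_true hn))
      hxy hxz hyz (by simp [G, hnxy]) (by simp [G, hnxz])
    exact eqv_rev_of_indCycle hd h hcard (fun i j hij hj => (hp i j hij hj).1)
      (fun i j hij hj => (hp i j hij hj).2) hsurj

end

theorem eqv_of_card_le {U : Type*} [Finite U] {d d' : U → U → Col} (h : Hyp d d')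
    (hU : Nat.card U ≤ 6) : Eqv d d' := by
  have e := (Finite.equivFin U).symm
  obtain ⟨g, hg⟩ := h _ hU e e.injective
  exact ⟨e.symm.trans (g.trans e), fun x y => by simpa using hg (e.symm x) (e.symm y)⟩

theorem Sys.of_hyp {U : Type*} {d d' : U → U → Col} (hd : Skew d) (hd' : Skew d')
    (h : Hyp d d') : Sys fun x y => Edge.enc (d x y) (d' x y) := by
  have hup := fun x y => Edge.up_enc (h.eq_or_eq_op hd hd' x y)
  refine ⟨fun x => ?_, fun x y => ?_, fun hxy hxz hyz => ?_, fun hxy hxz hxw hyz hyw hzw => ?_⟩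
  · rw [hd.1, hd'.1]
    rfl
  · rw [hd.2 x y, hd'.2 x y, Edge.enc_op]
  · simp only [ok3, Edge.lo_enc, hup]
    exact h.prof3 hd hd' hxy hxz hyz
  · simp only [ok4, Edge.lo_enc, hup]
    exact h.prof4 hd hd' hxy hxz hxw hyz hyw hzw

theorem Sys.eqv_of_H_connected {U : Type*} [Finite U] {c : U → U → Edge} (S : Sys c)
    (h : Hyp (fun x y => (c x y).lo) (fun x y => (c x y).up))
    (hH : ∀ x y, Relation.ReflTransGen (Sys.H c) x y) :
    Eqv (fun x y => (c x y).lo) (fun x y => (c x y).up) := by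
  by_cases hK : ∀ x y, Relation.ReflTransGen (Sys.K c) x y
  · exact S.eqv_of_K_connected hH hK
  rcases le_or_gt (Nat.card U) 6 with hU | hU
  · exact eqv_of_card_le h hU
  have h' : Hyp (fun x y => (c x y).lo) (rev fun x y => (c x y).lo) := fun k hk f hf =>
    (h k hk f hf).trans (S.eqv_rev_of_not_K_connected hH hK hf)
  exact (eqv_rev S.skew_lo h' hU fun x y => Relation.ReflTransGen.mono
      (fun _ _ => Sys.dir_of_isH) _ _ (hH x y)).trans
    (S.eqv_rev_of_not_K_connected hH hK Function.injective_id).symm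

theorem Hyp.eqv {U : Type*} [Finite U] {d d' : U → U → Col} (hd : Skew d) (hd' : Skew d')
    (h : Hyp d d') : Eqv d d' := by
  have S := Sys.of_hyp hd hd' h
  have hup := fun x y => Edge.up_enc (h.eq_or_eq_op hd hd' x y)
  have key := S.eqv_of_H_fibres fun q => (S.comp Subtype.val_injective).eqv_of_H_connected
    (by simpa only [Edge.lo_enc, hup] using h.comp Subtype.val_injective) (rtg_fibre S.H_symm)
  simpa only [Edge.lo_enc, hup] using key

open Classical in
/-- The pair-colouring of a digraph. -/
noncomputable def col {U : Type*} (G : Dgraph U) (x y : U) : Col :=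
  if G.Arc x y then if G.Arc y x then .full else .fwd
  else if G.Arc y x then .bwd else .void

theorem skew_col {U : Type*} (G : Dgraph U) : Skew (col G) := by
  refine ⟨fun x => by simp [col, G.irrefl], fun x y => ?_⟩
  by_cases h : G.Arc x y <;> by_cases h' : G.Arc y x <;> simp [col, h, h', Col.op]

theorem col_eq_iff {U U' : Type*} {G : Dgraph U} {G' : Dgraph U'} {x y : U} {x' y' : U'} :
    col G x y = col G' x' y' ↔ (G.Arc x y ↔ G'.Arc x' y') ∧ (G.Arc y x ↔ G'.Arc y' x') := by
  by_cases h₁ : G.Arc x y <;> by_cases h₂ : G.Arc y x <;> by_cases h₃ : G'.Arc x' y' <;>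
    by_cases h₄ : G'.Arc y' x' <;> simp [col, h₁, h₂, h₃, h₄]

theorem eqv_col_iff {U U' : Type*} {G : Dgraph U} {G' : Dgraph U'} :
    Eqv (col G) (col G') ↔ Iso G G' :=
  exists_congr fun _ => ⟨fun h x y => (col_eq_iff.1 (h x y)).1,
    fun h x y => col_eq_iff.2 ⟨h x y, h y x⟩⟩

theorem hyp_col {U : Type*} {G G' : Dgraph U} (h : LeHypo 6 G G') : Hyp (col G) (col G') := by
  intro k hk f hf
  rcases Nat.eq_zero_or_pos k with rfl | hk₀
  · exact ⟨Equiv.refl _, fun x => x.elim0⟩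
  · obtain ⟨e, he⟩ := h k hk₀ hk (Set.range f) (Set.finite_range f)
      (by rw [← Nat.card_coe_set_eq, Nat.card_range_of_injective hf, Nat.card_fin])
    let r := Equiv.ofInjective f hf
    have hr : ∀ x : Set.range f, f (r.symm x) = x := Equiv.apply_ofInjective_symm hf
    refine ⟨r.trans (e.trans r.symm), fun i j => ?_⟩
    simp only [Equiv.trans_apply, hr]
    exact col_eq_iff.2 ⟨he (r i) (r j), he (r j) (r i)⟩

end Lopez
end Dgraph

open Dgraph
/-- Lopez's theorem: finite digraphs are (≤6)-reconstructible. -/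
theorem finite_le_six_reconstructible {V : Type u} [Finite V] (G G' : Dgraph V)
    (h : Dgraph.LeHypo 6 G G') : Dgraph.Iso G G' := by
  exact Lopez.eqv_col_iff.1 ((Lopez.hyp_col h).eqv (Lopez.skew_col G) (Lopez.skew_col G'))
end

section
/- Let G=(V,A) and G'=(V,A') be two (≤3)-hypomorphic digraphs and let C∈D_{G,G'} be a difference class. Then: (1) G[C] is arc-connected and C is an interval of both G and G'; (2) if G'[C]≅G[C] for every difference class C∈D_{G,G'}, then G≅G'. -/
universe u v

open Dgraph
namespace Dgraph

variable {V : Type u} {G G' : Dgraph V}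

theorem isInterval_iff {I : Set V} :
    G.IsInterval I ↔ ∀ x ∉ I, ∀ y ∈ I, ∀ z ∈ I,
      (G.Arc x y ↔ G.Arc x z) ∧ (G.Arc y x ↔ G.Arc z x) := by
  constructor
  · intro h x hx y hy z hz
    rcases h x hx with h | h | h | h <;> simp [h y hy, h z hz]
  · intro h x hx
    rcases I.eq_empty_or_nonempty with rfl | ⟨y, hy⟩
    · simp
    · by_cases h₁ : G.Arc x y <;> by_cases h₂ : G.Arc y x
      · exact .inr <| .inr <| .inl fun z hz => by simp [← h x hx y hy z hz, h₁, h₂]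
      · exact .inl fun z hz => by simp [← h x hx y hy z hz, h₁, h₂]
      · exact .inr <| .inl fun z hz => by simp [← h x hx y hy z hz, h₁, h₂]
      · exact .inr <| .inr <| .inr fun z hz => by simp [← h x hx y hy z hz, h₁, h₂]

/-- `{2}`-hypomorphic digraphs either agree on a pair or are opposite on it. -/
theorem KHypo.pair (h : KHypo 2 G G') {x y : V} (hxy : x ≠ y) :
    ((G.Arc x y ↔ G'.Arc x y) ∧ (G.Arc y x ↔ G'.Arc y x)) ∨
      ((G.Arc x y ↔ G'.Arc y x) ∧ (G.Arc y x ↔ G'.Arc x y)) := by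
  obtain ⟨e, he⟩ := h {x, y} (Set.toFinite _) (Set.ncard_pair hxy)
  let a : ({x, y} : Set V) := ⟨x, by simp⟩
  let b : ({x, y} : Set V) := ⟨y, by simp⟩
  have hne : (e a).1 ≠ (e b).1 := fun hab =>
    hxy (congrArg Subtype.val (e.injective (Subtype.ext hab)))
  have h₁ : G.Arc x y ↔ G'.Arc (e a).1 (e b).1 := he a b
  have h₂ : G.Arc y x ↔ G'.Arc (e b).1 (e a).1 := he b a
  have ha : (e a).1 = x ∨ (e a).1 = y := (e a).2
  have hb : (e b).1 = x ∨ (e b).1 = y := (e b).2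
  rcases ha with ha | ha <;> rcases hb with hb | hb <;> simp_all

/-- The key fact on triples: if `x` is in agreement with both ends of a reversed pair `{y, z}`,
then `x` relates to `y` and `z` in the same way. -/
theorem KHypo.triple (h : KHypo 3 G G') {x y z : V} (hxy : x ≠ y) (hxz : x ≠ z) (hyz : y ≠ z)
    (h₁ : G.Arc x y ↔ G'.Arc x y) (h₂ : G.Arc y x ↔ G'.Arc y x)
    (h₃ : G.Arc x z ↔ G'.Arc x z) (h₄ : G.Arc z x ↔ G'.Arc z x)
    (h₅ : G.Arc y z ↔ ¬ G'.Arc y z) (h₆ : G.Arc z y ↔ ¬ G'.Arc z y)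
    (h₇ : G.Arc y z ↔ ¬ G.Arc z y) :
    (G.Arc x y ↔ G.Arc x z) ∧ (G.Arc y x ↔ G.Arc z x) := by
  obtain ⟨e, he⟩ := h {x, y, z} (Set.toFinite _) (Set.ncard_eq_three.2 ⟨x, y, z, hxy, hxz, hyz, rfl⟩)
  let a : ({x, y, z} : Set V) := ⟨x, by simp⟩
  let b : ({x, y, z} : Set V) := ⟨y, by simp⟩
  let c : ({x, y, z} : Set V) := ⟨z, by simp⟩
  have hab : (e a).1 ≠ (e b).1 := fun hh =>
    hxy (congrArg Subtype.val (e.injective (Subtype.ext hh)))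
  have hac : (e a).1 ≠ (e c).1 := fun hh =>
    hxz (congrArg Subtype.val (e.injective (Subtype.ext hh)))
  have hbc : (e b).1 ≠ (e c).1 := fun hh =>
    hyz (congrArg Subtype.val (e.injective (Subtype.ext hh)))
  have k₁ : G.Arc x y ↔ G'.Arc (e a).1 (e b).1 := he a b
  have k₂ : G.Arc y x ↔ G'.Arc (e b).1 (e a).1 := he b a
  have k₃ : G.Arc x z ↔ G'.Arc (e a).1 (e c).1 := he a c
  have k₄ : G.Arc z x ↔ G'.Arc (e c).1 (e a).1 := he c a
  have k₅ : G.Arc y z ↔ G'.Arc (e b).1 (e c).1 := he b c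
  have k₆ : G.Arc z y ↔ G'.Arc (e c).1 (e b).1 := he c b
  have ha : (e a).1 = x ∨ (e a).1 = y ∨ (e a).1 = z := (e a).2
  have hb : (e b).1 = x ∨ (e b).1 = y ∨ (e b).1 = z := (e b).2
  have hc : (e c).1 = x ∨ (e c).1 = y ∨ (e c).1 = z := (e c).2
  clear he
  generalize (e a).1 = a' at *
  generalize (e b).1 = b' at *
  generalize (e c).1 = c' at *
  rcases ha with rfl | rfl | rfl <;> rcases hb with rfl | rfl | rfl <;>
    first
    | exact absurd rfl hab
    | (rcases hc with rfl | rfl | rfl <;>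
        first
        | exact absurd rfl hac
        | exact absurd rfl hbc
        | grind)

theorem DiffStep.ne {x y : V} (h : DiffStep G G' x y) : x ≠ y := by
  rintro rfl
  simp [DiffStep, G.irrefl, G'.irrefl] at h

theorem DiffStep.symm (h2 : KHypo 2 G G') {x y : V} (h : DiffStep G G' x y) :
    DiffStep G G' y x := by
  have := h2.pair h.ne
  unfold DiffStep at *
  grind

theorem DiffStep.arc_iff (h2 : KHypo 2 G G') {x y : V} (h : DiffStep G G' x y) :
    G.Arc x y ↔ ¬ G.Arc y x := by
  have := h2.pair h.ne
  unfold DiffStep at *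
  grind

theorem diffRel_iff {x y : V} :
    DiffRel G G' x y ↔ Relation.ReflTransGen (DiffStep G G') x y := by
  rw [Relation.reflTransGen_iff_eq_or_transGen, eq_comm]
  rfl

theorem arc_iff_of_not_diffRel {x y : V} (h : ¬ DiffRel G G' x y) :
    G.Arc x y ↔ G'.Arc x y := by
  have : ¬ DiffStep G G' x y := fun hs => h (.inr (.single hs))
  unfold DiffStep at this
  tauto

theorem diffRel_equivalence (h2 : KHypo 2 G G') : Equivalence (DiffRel G G') where
  refl _ := .inl rfl
  symm h := by
    have : Std.Symm (DiffStep G G') := ⟨fun _ _ hs => hs.symm h2⟩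
    rw [diffRel_iff] at h ⊢
    exact Std.Symm.symm _ _ h
  trans h₁ h₂ := by
    rw [diffRel_iff] at *
    exact h₁.trans h₂

theorem DiffClass.arcConnected (h2 : KHypo 2 G G') {C : Set V} (hC : DiffClass G G' C) :
    (G.ind C).ArcConnected := by
  obtain ⟨x, rfl⟩ := hC
  have eqv := diffRel_equivalence h2
  rintro ⟨a, ha⟩ ⟨b, hb⟩
  have hab := diffRel_iff.1 (eqv.trans (eqv.symm ha) hb)
  revert ha
  induction hab using Relation.ReflTransGen.head_induction_on with
  | refl => exact fun _ => .refl
  | head hs _ ih =>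
    intro ha
    refine .head ?_ (ih (eqv.trans ha (.inr (.single hs))))
    have := hs.arc_iff h2
    simp only [Dir, ind]
    tauto

/-- A vertex not related to `y` sees the whole difference class of `y` in the same way. -/
theorem arc_iff_of_diffRel (h2 : KHypo 2 G G') (h3 : KHypo 3 G G') {x y z : V}
    (hxy : ¬ DiffRel G G' x y) (hyz : DiffRel G G' y z) :
    (G.Arc x y ↔ G.Arc x z) ∧ (G.Arc y x ↔ G.Arc z x) := by
  have eqv := diffRel_equivalence h2
  have agree {v : V} (hv : ¬ DiffRel G G' x v) :
      (G.Arc x v ↔ G'.Arc x v) ∧ (G.Arc v x ↔ G'.Arc v x) :=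
    ⟨arc_iff_of_not_diffRel hv, arc_iff_of_not_diffRel fun h => hv (eqv.symm h)⟩
  rw [diffRel_iff] at hyz
  induction hyz with
  | refl => simp
  | @tail b c hyb hs ih =>
    have hxb : ¬ DiffRel G G' x b := fun h => hxy (eqv.trans h (eqv.symm (diffRel_iff.2 hyb)))
    have hxc : ¬ DiffRel G G' x c := fun h => hxb (eqv.trans h (eqv.symm (.inr (.single hs))))
    have := h3.triple (fun h => hxb (.inl h)) (fun h => hxc (.inl h)) hs.ne
      (agree hxb).1 (agree hxb).2 (agree hxc).1 (agree hxc).2 hs (hs.symm h2) (hs.arc_iff h2)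
    exact ⟨ih.1.trans this.1, ih.2.trans this.2⟩

theorem DiffClass.isInterval (h2 : KHypo 2 G G') (h3 : KHypo 3 G G') {C : Set V}
    (hC : DiffClass G G' C) : G.IsInterval C := by
  obtain ⟨w, rfl⟩ := hC
  have eqv := diffRel_equivalence h2
  exact isInterval_iff.2 fun x hx y hy z hz => arc_iff_of_diffRel h2 h3
    (fun h => hx (eqv.trans hy (eqv.symm h))) (eqv.trans (eqv.symm hy) hz)

theorem Iso.symm {W : Type v} {H : Dgraph W} (h : Iso G H) : Iso H G := by
  obtain ⟨e, he⟩ := h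
  exact ⟨e.symm, fun x y => by simp [he]⟩

theorem KHypo.symm {k : ℕ} (h : KHypo k G G') : KHypo k G' G :=
  fun X hX hk => (h X hX hk).symm

theorem diffRel_comm {x y : V} : DiffRel G G' x y ↔ DiffRel G' G x y := by
  have : DiffStep G G' = DiffStep G' G := by
    ext x y
    unfold DiffStep
    tauto
  simp [DiffRel, this]

theorem DiffClass.swap {C : Set V} (hC : DiffClass G G' C) : DiffClass G' G C := by
  obtain ⟨x, rfl⟩ := hC
  exact ⟨x, by simp [diffRel_comm]⟩

/-- Isomorphisms between the difference classes glue to a global isomorphism. -/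
theorem iso_of_diffClass_iso (h2 : KHypo 2 G G') (h3 : KHypo 3 G G')
    (hiso : ∀ C : Set V, DiffClass G G' C → Iso (G.ind C) (G'.ind C)) : Iso G G' := by
  have eqv := diffRel_equivalence h2
  let S : Setoid V := ⟨DiffRel G G', eqv⟩
  have key (q : Quotient S) : Iso (G.ind {v | Quotient.mk S v = q})
      (G'.ind {v | Quotient.mk S v = q}) := by
    induction q using Quotient.inductionOn with
    | h x =>
      refine hiso _ ⟨x, ?_⟩
      ext y
      exact Quotient.eq.trans ⟨eqv.symm, eqv.symm⟩
  choose e he using key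
  let f : V ≃ V := Equiv.ofFiberEquiv (f := Quotient.mk S) (g := Quotient.mk S) e
  have hf (v : V) : DiffRel G G' v (f v) :=
    eqv.symm (Quotient.exact (Equiv.ofFiberEquiv_map _ v))
  refine ⟨f, fun x y => ?_⟩
  by_cases hxy : DiffRel G G' x y
  · have hq : Quotient.mk S x = Quotient.mk S y := Quotient.sound hxy
    have hfy : f y = e (Quotient.mk S x) ⟨y, hq.symm⟩ := by
      have (q : Quotient S) (hq : Quotient.mk S y = q) : f y = e q ⟨y, hq⟩ := by
        subst hq
        rfl
      exact this _ hq.symm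
    have hfx : f x = e (Quotient.mk S x) ⟨x, rfl⟩ := rfl
    rw [hfx, hfy]
    exact he _ ⟨x, rfl⟩ ⟨y, hq.symm⟩
  · have hxfy : ¬ DiffRel G G' x (f y) := fun h => hxy (eqv.trans h (eqv.symm (hf y)))
    have hfxfy : ¬ DiffRel G G' (f x) (f y) := fun h => hxfy (eqv.trans (hf x) h)
    exact (arc_iff_of_diffRel h2 h3 hxy (hf y)).1.trans <|
      (arc_iff_of_diffRel h2 h3 (fun h => hxfy (eqv.symm h)) (hf x)).2.trans <|
        arc_iff_of_not_diffRel hfxfy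

end Dgraph

/-- Lopez's lemma on difference classes of (≤3)-hypomorphic digraphs. -/
theorem lopez_diff_class_lemma {V : Type u} (G G' : Dgraph V)
    (h : Dgraph.LeHypo 3 G G') (C : Set V) (hC : Dgraph.DiffClass G G' C) :
    ((G.ind C).ArcConnected ∧ G.IsInterval C ∧ G'.IsInterval C) ∧
    ((∀ C' : Set V, Dgraph.DiffClass G G' C' → Dgraph.Iso (G'.ind C') (G.ind C')) →
      Dgraph.Iso G G') := by
  have h2 := h 2 (by norm_num) (by norm_num)
  have h3 := h 3 (by norm_num) le_rfl
  exact ⟨⟨hC.arcConnected h2, hC.isInterval h2 h3, hC.swap.isInterval h2.symm h3.symm⟩,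
    fun hiso => iso_of_diffClass_iso h2 h3 fun C' hC' => (hiso C' hC').symm⟩
end
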